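/- Let p and q be primes, both congruent to 1 modulo 4, with p > 1250, let k ≥ 1, and set m = 5·q^k; assume p is coprime to m and that −1 and p are squares modulo m. Then the diameter of the LPS Ramanujan graph X_{p,m} on PSL₂(ZMod m) satisfies diam ≥ ⌊(4/3)·log_p(n)⌋, where n is the number of vertices of X_{p,m} (the cardinality of PSL₂(ZMod m)). -/

import Mathlib

open Matrix

/-- The symmetric integer matrix `!![a, d, e; d, b, f; e, f, c]` is the Gram matrix of three vectors
of the standard lattice `ℤ³`. -/
def IsStdGram (a b c d e f : ℤ) : Prop :=
  ∃ x y z : Fin 3 → ℤ, x ⬝ᵥ x = a ∧ y ⬝ᵥ y = b ∧ z ⬝ᵥ z = c ∧ x ⬝ᵥ y = d ∧ x ⬝ᵥ z = e ∧ y ⬝ᵥ z = f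

namespace IsStdGram

variable {a b c d e f : ℤ}

lemma of_swap₁₂ (h : IsStdGram b a c d f e) : IsStdGram a b c d e f := by
  obtain ⟨x, y, z, h₁, h₂, h₃, h₄, h₅, h₆⟩ := h
  exact ⟨y, x, z, h₂, h₁, h₃, by rw [dotProduct_comm, h₄], h₆, h₅⟩

lemma of_swap₂₃ (h : IsStdGram a c b e d f) : IsStdGram a b c d e f := by
  obtain ⟨x, y, z, h₁, h₂, h₃, h₄, h₅, h₆⟩ := h
  exact ⟨x, z, y, h₁, h₃, h₂, h₅, h₄, by rw [dotProduct_comm, h₆]⟩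

lemma of_shear₁₂ (k : ℤ)
    (h : IsStdGram a (b + 2 * k * d + k ^ 2 * a) c (d + k * a) e (f + k * e)) :
    IsStdGram a b c d e f := by
  obtain ⟨x, y, z, h₁, h₂, h₃, h₄, h₅, h₆⟩ := h
  refine ⟨x, y - k • x, z, h₁, ?_, h₃, ?_, h₅, ?_⟩
  · have : y ⬝ᵥ x = d + k * a := by rw [dotProduct_comm, h₄]
    simp only [sub_dotProduct, dotProduct_sub, smul_dotProduct, dotProduct_smul, smul_eq_mul, h₁,
      h₂, h₄, this]
    ring
  · simp only [dotProduct_sub, dotProduct_smul, smul_eq_mul, h₁, h₄]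
    ring
  · simp only [sub_dotProduct, smul_dotProduct, smul_eq_mul, h₅, h₆]
    ring

lemma of_shear₁₃ (k : ℤ)
    (h : IsStdGram a b (c + 2 * k * e + k ^ 2 * a) d (e + k * a) (f + k * d)) :
    IsStdGram a b c d e f :=
  of_swap₂₃ (of_shear₁₂ k (of_swap₂₃ h))

lemma of_shear₂₃ (k : ℤ)
    (h : IsStdGram a b (c + 2 * k * f + k ^ 2 * b) d (e + k * d) (f + k * b)) :
    IsStdGram a b c d e f :=
  of_swap₁₂ (of_shear₁₃ k (of_swap₁₂ h))

end IsStdGram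

lemma exists_two_mul_add_mul_le {a : ℤ} (ha : 0 < a) (d : ℤ) :
    ∃ k, -a ≤ 2 * (d + k * a) ∧ 2 * (d + k * a) ≤ a := by
  refine ⟨-((2 * d + a) / (2 * a)), ?_, ?_⟩
  · have := Int.mul_ediv_self_le (x := 2 * d + a) (k := 2 * a) (by omega)
    linarith
  · have := Int.lt_mul_ediv_self_add (x := 2 * d + a) (k := 2 * a) (by omega)
    linarith

/-- A reduced positive definite ternary form of determinant one is the standard one. -/
lemma eq_one_of_reduced {a b c d e f : ℤ} (ha : 0 < a) (hg : 0 < a * b - d ^ 2)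
    (hdet : a * b * c + 2 * d * e * f - a * f ^ 2 - b * e ^ 2 - c * d ^ 2 = 1)
    (hd₁ : -a ≤ 2 * d) (hd₂ : 2 * d ≤ a) (he₁ : -a ≤ 2 * e) (he₂ : 2 * e ≤ a)
    (hf₁ : -(a * b - d ^ 2) ≤ 2 * (a * f - d * e)) (hf₂ : 2 * (a * f - d * e) ≤ a * b - d ^ 2)
    (hab : a ≤ b) (hgg : a * b - d ^ 2 ≤ a * c - e ^ 2) :
    a = 1 ∧ b = 1 ∧ c = 1 ∧ d = 0 ∧ e = 0 ∧ f = 0 := by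
  have hdet' : (a * b - d ^ 2) * (a * c - e ^ 2) - (a * f - d * e) ^ 2 = a := by
    linear_combination a * hdet
  have h₁ : 3 * (a * b - d ^ 2) ^ 2 ≤ 4 * a := by nlinarith
  have h₂ : 3 * a ^ 2 ≤ 4 * (a * b - d ^ 2) := by nlinarith
  have ha₂ : a < 2 := by
    by_contra! h
    have : 9 * (a ^ 2) ^ 2 ≤ 16 * (a * b - d ^ 2) ^ 2 := by nlinarith [sq_nonneg a]
    have : 27 * a ^ 4 ≤ 64 * a := by nlinarith
    nlinarith [mul_nonneg ha.le (sq_nonneg a), mul_nonneg ha.le (sq_nonneg (a - 2)),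
      sq_nonneg (a - 2), sq_nonneg (a ^ 2)]
  obtain rfl : a = 1 := by omega
  obtain rfl : d = 0 := by omega
  obtain rfl : e = 0 := by omega
  obtain rfl : b = 1 := by nlinarith
  obtain rfl : f = 0 := by omega
  exact ⟨rfl, rfl, by linarith, rfl, rfl, rfl⟩

/-- Every positive definite ternary integral form of determinant one is a sum of three squares. -/
theorem isStdGram_of_det_eq_one (a b c d e f : ℤ) (ha : 0 < a) (hg : 0 < a * b - d ^ 2)
    (hdet : a * b * c + 2 * d * e * f - a * f ^ 2 - b * e ^ 2 - c * d ^ 2 = 1) :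
    IsStdGram a b c d e f := by
  obtain ⟨k, hk₁, hk₂⟩ := exists_two_mul_add_mul_le ha d
  apply IsStdGram.of_shear₁₂ k
  have hg' : a * (b + 2 * k * d + k ^ 2 * a) - (d + k * a) ^ 2 = a * b - d ^ 2 := by ring
  replace hdet : a * (b + 2 * k * d + k ^ 2 * a) * c + 2 * (d + k * a) * e * (f + k * e) -
      a * (f + k * e) ^ 2 - (b + 2 * k * d + k ^ 2 * a) * e ^ 2 - c * (d + k * a) ^ 2 = 1 := by
    linear_combination hdet
  generalize b + 2 * k * d + k ^ 2 * a = b', d + k * a = d', f + k * e = f' at *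
  have hg₁ : 0 < a * b' - d' ^ 2 := by omega
  obtain ⟨l, hl₁, hl₂⟩ := exists_two_mul_add_mul_le hg₁ (a * f' - d' * e)
  apply IsStdGram.of_shear₂₃ l
  replace hdet : a * b' * (c + 2 * l * f' + l ^ 2 * b') + 2 * d' * (e + l * d') * (f' + l * b') -
      a * (f' + l * b') ^ 2 - b' * (e + l * d') ^ 2 - (c + 2 * l * f' + l ^ 2 * b') * d' ^ 2
        = 1 := by
    linear_combination hdet
  have hf : a * f' - d' * e + l * (a * b' - d' ^ 2) = a * (f' + l * b') - d' * (e + l * d') := by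
    ring
  rw [hf] at hl₁ hl₂
  generalize c + 2 * l * f' + l ^ 2 * b' = c₁, e + l * d' = e₁, f' + l * b' = f₁ at *
  obtain ⟨j, hj₁, hj₂⟩ := exists_two_mul_add_mul_le ha e₁
  apply IsStdGram.of_shear₁₃ j
  replace hdet : a * b' * (c₁ + 2 * j * e₁ + j ^ 2 * a) + 2 * d' * (e₁ + j * a) * (f₁ + j * d') -
      a * (f₁ + j * d') ^ 2 - b' * (e₁ + j * a) ^ 2 - (c₁ + 2 * j * e₁ + j ^ 2 * a) * d' ^ 2
        = 1 := by
    linear_combination hdet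
  have hf : a * f₁ - d' * e₁ = a * (f₁ + j * d') - d' * (e₁ + j * a) := by ring
  rw [hf] at hl₁ hl₂
  generalize c₁ + 2 * j * e₁ + j ^ 2 * a = c', e₁ + j * a = e', f₁ + j * d' = f' at *
  have hb' : 0 < b' := by
    by_contra! h
    nlinarith [sq_nonneg d']
  have hdet' : (a * b' - d' ^ 2) * (a * c' - e' ^ 2) - (a * f' - d' * e') ^ 2 = a := by
    linear_combination a * hdet
  have hg₂ : 0 < a * c' - e' ^ 2 := by
    by_contra! h
    nlinarith [sq_nonneg (a * f' - d' * e')]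
  rcases lt_or_ge b' a with hba | hab
  · apply IsStdGram.of_swap₁₂
    exact isStdGram_of_det_eq_one b' a c' d' f' e' hb' (by linarith) (by linear_combination hdet)
  rcases lt_or_ge (a * c' - e' ^ 2) (a * b' - d' ^ 2) with hcb | hbc
  · apply IsStdGram.of_swap₂₃
    exact isStdGram_of_det_eq_one a c' b' e' d' f' ha hg₂ (by linear_combination hdet)
  obtain ⟨rfl, rfl, rfl, rfl, rfl, rfl⟩ :=
    eq_one_of_reduced ha hg₁ hdet hk₁ hk₂ hj₁ hj₂ hl₁ hl₂ hab hbc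
  exact ⟨![1, 0, 0], ![0, 1, 0], ![0, 0, 1], by simp [dotProduct, Fin.sum_univ_three]⟩
termination_by (a.toNat, (a * b - d ^ 2).toNat)
decreasing_by
  · left; omega
  · right; omega

/-- A positive integer `n ≡ 2 mod 4` is primitively a sum of three squares. -/
theorem exists_primitive_sum_three_squares {n : ℕ} (hn : n % 4 = 2) :
    ∃ a b c a' b' c' : ℤ, a ^ 2 + b ^ 2 + c ^ 2 = n ∧ a * a' + b * b' + c * c' = 1 := by
  have hcop : (n - 1).Coprime (4 * n) := by
    apply Nat.Coprime.mul_right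
    · have : (n - 1).Coprime 2 := by rw [Nat.coprime_two_right, Nat.odd_iff]; omega
      exact this.pow_right 2
    · rw [Nat.coprime_comm, Nat.coprime_self_sub_right (by omega)]
      simp
  obtain ⟨r, hr, hrp, hrn⟩ := Nat.forall_exists_prime_gt_and_modEq (n + 1) (by omega) hcop
  have : Fact r.Prime := ⟨hrp⟩
  obtain ⟨v, hv⟩ := (Nat.modEq_iff_dvd' (by omega)).1 hrn.symm
  have hrv : r + 1 = (4 * v + 1) * n := by
    zify [show n - 1 ≤ r by omega, show 1 ≤ n by omega] at hv ⊢
    linarith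
  have hr4 : r % 4 = 1 := by
    have : (r + 1) % 4 = 2 := by rw [hrv, Nat.mul_mod]; simp [Nat.add_mod, hn]
    omega
  have hro : Odd r := Nat.odd_iff.2 (by omega)
  have hbo : Odd (4 * v + 1) := Nat.odd_iff.2 (by omega)
  have hJ : jacobiSym (-((4 * v + 1 : ℕ) : ℤ)) r = 1 := by
    rw [jacobiSym.neg _ hro, ZMod.χ₄_nat_one_mod_four hr4, one_mul,
      jacobiSym.quadratic_reciprocity_one_mod_four (by omega) hro]
    have : jacobiSym (r : ℤ) (4 * v + 1) = jacobiSym (-1) (4 * v + 1) := by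
      apply jacobiSym.mod_left'
      apply Int.ModEq.symm
      rw [Int.modEq_iff_dvd]
      refine ⟨n, ?_⟩
      push_cast
      have : ((r : ℤ) + 1) = (4 * v + 1) * n := by exact_mod_cast hrv
      linarith
    rw [this, jacobiSym.at_neg_one hbo, ZMod.χ₄_nat_one_mod_four (by omega)]
  obtain ⟨d, hd⟩ := ZMod.isSquare_of_jacobiSym_eq_one hJ
  obtain ⟨d, rfl⟩ := ZMod.intCast_surjective d
  have hd' : (r : ℤ) ∣ d ^ 2 + (4 * v + 1 : ℕ) := by
    rw [← ZMod.intCast_zmod_eq_zero_iff_dvd]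
    push_cast at hd ⊢
    linear_combination -hd
  obtain ⟨a, ha⟩ := hd'
  have hr0 : (0 : ℤ) < r := by exact_mod_cast hrp.pos
  have ha0 : 0 < a := by
    by_contra! h
    have : (r : ℤ) * a ≤ 0 := by nlinarith
    have : (0 : ℤ) < (4 * v + 1 : ℕ) := by positivity
    nlinarith [sq_nonneg d]
  have hrv' : (r : ℤ) + 1 = (4 * v + 1 : ℕ) * n := by exact_mod_cast hrv
  obtain ⟨x, y, z, -, -, hz, -, hxz, -⟩ := isStdGram_of_det_eq_one a r n d 1 0 ha0
    (by have : (0 : ℤ) < (4 * v + 1 : ℕ) := by positivity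
        nlinarith) (by linear_combination -hrv' - n * ha)
  refine ⟨z 0, z 1, z 2, x 0, x 1, x 2, ?_, ?_⟩
  · simp only [dotProduct, Fin.sum_univ_three] at hz
    linarith
  · simp only [dotProduct, Fin.sum_univ_three] at hxz
    linarith

lemma exists_sum_sq_sub_lt {p r : ℤ} (hpo : Odd p) (hr : 0 < r) (a b c d : ℤ)
    (h : a ^ 2 + b ^ 2 + c ^ 2 + d ^ 2 = p * r) :
    ∃ a' b' c' d', (a - r * a') ^ 2 + (b - r * b') ^ 2 + (c - r * c') ^ 2 + (d - r * d') ^ 2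
      < r ^ 2 := by
  have key : ∀ x : ℤ, ∃ x', 4 * (x - r * x') ^ 2 ≤ r ^ 2 ∧
      (4 * (x - r * x') ^ 2 = r ^ 2 → ∃ t, 2 * x = r * (2 * t + 1)) := fun x ↦ by
    obtain ⟨k, h₁, h₂⟩ := exists_two_mul_add_mul_le hr x
    refine ⟨-k, by nlinarith, fun h ↦ ?_⟩
    have : (2 * (x + k * r) - r) * (2 * (x + k * r) + r) = 0 := by linear_combination h
    rcases mul_eq_zero.1 this with h | h
    · exact ⟨-k, by linear_combination h⟩
    · exact ⟨-k - 1, by linear_combination h⟩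
  obtain ⟨a', ha₁, ha₂⟩ := key a
  obtain ⟨b', hb₁, hb₂⟩ := key b
  obtain ⟨c', hc₁, hc₂⟩ := key c
  obtain ⟨d', hd₁, hd₂⟩ := key d
  refine ⟨a', b', c', d', ?_⟩
  by_contra! hle
  obtain ⟨t, ht⟩ := ha₂ (by linarith)
  obtain ⟨u, hu⟩ := hb₂ (by linarith)
  obtain ⟨v, hv⟩ := hc₂ (by linarith)
  obtain ⟨w, hw⟩ := hd₂ (by linarith)
  have : r * (4 * p) = r * (r * ((2 * t + 1) ^ 2 + (2 * u + 1) ^ 2 + (2 * v + 1) ^ 2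
      + (2 * w + 1) ^ 2)) := by
    linear_combination -4 * h + (2 * a + r * (2 * t + 1)) * ht + (2 * b + r * (2 * u + 1)) * hu
      + (2 * c + r * (2 * v + 1)) * hv + (2 * d + r * (2 * w + 1)) * hw
  replace this := mul_left_cancel₀ hr.ne' this
  have hp : p = r * (t ^ 2 + t + u ^ 2 + u + v ^ 2 + v + w ^ 2 + w + 1) := by linarith
  have hr2 : Even r := by
    rcases Int.even_or_odd r with h | h
    · exact h
    · exfalso
      have h1 : Even (r * (2 * t + 1)) := ht ▸ even_two_mul a
      rw [Int.even_mul, Int.even_add_one] at h1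
      rcases h1 with h1 | h1
      · exact Int.not_even_iff_odd.2 h h1
      · exact h1 (even_two_mul t)
  exact Int.not_even_iff_odd.2 hpo (hp ▸ hr2.mul_right _)

namespace Quaternion

lemma exists_dvd_mul_star_of_lt {p : ℕ} (hp : p.Prime) (hpo : Odd p) (x : Quaternion ℤ) (r : ℕ)
    (hr₀ : 0 < r) (hrp : r < p) (α : Quaternion ℤ) (hα : normSq α = p * r)
    (hdvd : ∃ y, x * star α = p * y) :
    ∃ α y : Quaternion ℤ, normSq α = p ∧ x * star α = p * y := by
  induction r using Nat.strong_induction_on generalizing α with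
  | _ r ih =>
    obtain ⟨y, hy⟩ := hdvd
    rcases (show r = 1 ∨ 1 < r by omega) with rfl | hr1
    · exact ⟨α, y, by simpa using hα, hy⟩
    have hr0 : (r : ℤ) ≠ 0 := by positivity
    obtain ⟨a, b, c, d, hlt⟩ := exists_sum_sq_sub_lt (p := p) (r := r) (by exact_mod_cast hpo)
      (by positivity) α.re α.imI α.imJ α.imK (by rw [← hα, normSq_def'])
    obtain ⟨δ, hδ₁, hδ₂, hδ₃, hδ₄⟩ : ∃ δ : Quaternion ℤ,
      δ.re = a ∧ δ.imI = b ∧ δ.imJ = c ∧ δ.imK = d := ⟨⟨a, b, c, d⟩, rfl, rfl, rfl, rfl⟩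
    have hβ : normSq (α - r * δ : Quaternion ℤ) < (r : ℤ) ^ 2 := by
      refine lt_of_eq_of_lt ?_ hlt
      rw [normSq_def']
      simp [hδ₁, hδ₂, hδ₃, hδ₄]
    have hmul : star (α - r * δ) * α = r * (p - star δ * α) := by
      have : star α * α = (p * r : ℕ) := by
        rw [star_mul_self, hα]
        push_cast
        rfl
      rw [star_sub, star_mul, sub_mul, this, star_natCast, mul_sub]
      push_cast
      rw [(Nat.cast_commute r _).eq, (Nat.cast_commute r (star δ)).symm.eq, mul_assoc]
    have hnorm : (r : ℤ) * normSq (p - star δ * α : Quaternion ℤ) = p * normSq (α - r * δ : Quaternion ℤ) := by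
      have := congrArg normSq hmul
      rw [map_mul, map_mul, normSq_star, hα, normSq_natCast] at this
      apply mul_left_cancel₀ hr0
      linear_combination -this
    have hpr : ¬ (p : ℤ) ∣ r := by
      rw [Int.natCast_dvd_natCast]
      exact Nat.not_dvd_of_pos_of_lt hr₀ hrp
    obtain ⟨t, ht⟩ : (p : ℤ) ∣ normSq (p - star δ * α : Quaternion ℤ) :=
      ((Nat.prime_iff_prime_int.1 hp).dvd_or_dvd (hnorm ▸ dvd_mul_right _ _)).resolve_left hpr
    have hp0 : (0 : ℤ) < p := by exact_mod_cast hp.pos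
    have htr : (r : ℤ) * t = normSq (α - r * δ : Quaternion ℤ) := by
      apply mul_left_cancel₀ hp0.ne'
      rw [← hnorm, ht]
      ring
    have ht0 : 0 < t := by
      have h0 : 0 ≤ normSq (α - r * δ : Quaternion ℤ) := normSq_nonneg
      rcases h0.eq_or_lt with h0 | h0
      · exfalso
        have := normSq_eq_zero.1 h0.symm
        rw [sub_eq_zero] at this
        rw [this, map_mul, normSq_natCast] at hα
        have : (r : ℤ) * normSq δ = p := by
          apply mul_left_cancel₀ hr0
          linear_combination hα
        have hdvd : r ∣ p := by
          rw [← Int.natCast_dvd_natCast]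
          exact ⟨_, this.symm⟩
        rcases (Nat.dvd_prime hp).1 hdvd with h | h <;> omega
      · rw [← htr] at h0
        exact pos_of_mul_pos_right h0 (by positivity)
    have htr' : t < r := by
      have : (r : ℤ) * t < r * r := by rw [htr]; linarith
      exact lt_of_mul_lt_mul_left this (by positivity)
    lift t to ℕ using ht0.le
    refine ih t (by omega) (by omega) (by omega) _ ht ⟨x - y * δ, ?_⟩
    rw [star_sub, star_natCast, star_mul, star_star, mul_sub, ← mul_assoc, hy, mul_sub,
      (Nat.cast_commute p x).eq, mul_assoc]

/-- An integral quaternion whose norm is divisible by an odd prime `p` has a right divisor of norm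
`p`. -/
theorem exists_eq_mul_of_dvd_normSq {p : ℕ} (hp : p.Prime) (hpo : Odd p) (x : Quaternion ℤ)
    (hx : (p : ℤ) ∣ normSq x) : ∃ y α : Quaternion ℤ, x = y * α ∧ normSq α = p := by
  suffices ∃ α y : Quaternion ℤ, normSq α = p ∧ x * star α = p * y by
    obtain ⟨α, y, hα, hy⟩ := this
    refine ⟨y, α, ?_, hα⟩
    have : (p : Quaternion ℤ) * x = p * (y * α) := by
      rw [← mul_assoc, ← hy, mul_assoc, star_mul_self, hα, (Nat.cast_commute p x).eq]
      rfl
    have hp0 : (p : Quaternion ℤ) ≠ 0 := fun h ↦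
      hp.ne_zero (by simpa using congrArg QuaternionAlgebra.re h)
    exact mul_left_cancel₀ hp0 this
  have hp0 : (0 : ℤ) < p := by exact_mod_cast hp.pos
  obtain ⟨N, hN⟩ := hx
  by_cases hdiv : ∃ z, x = p * z
  · obtain ⟨z, rfl⟩ := hdiv
    obtain ⟨a, b, c, d, h⟩ := Nat.sum_four_squares p
    let α : Quaternion ℤ := ⟨a, b, c, d⟩
    have hα : normSq α = p := by
      rw [normSq_def', ← h]
      push_cast
      rfl
    refine ⟨α, z * star α, hα, by rw [mul_assoc]⟩
  · have key : ∀ a : ℤ, ∃ a', 4 * (a - p * a') ^ 2 < p ^ 2 := fun a ↦ by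
      obtain ⟨k, h₁, h₂⟩ := exists_two_mul_add_mul_le hp0 a
      refine ⟨-k, ?_⟩
      have h₃ : 2 * (a + k * p) ≠ p := fun h ↦
        Int.not_even_iff_odd.2 (by exact_mod_cast hpo : Odd (p : ℤ)) (h ▸ even_two_mul _)
      have h₄ : 2 * (a + k * p) ≠ -p := fun h ↦
        Int.not_even_iff_odd.2 (by exact_mod_cast hpo : Odd (p : ℤ))
          (even_neg.1 (h ▸ even_two_mul _))
      have h₅ : 2 * (a + k * p) < p := lt_of_le_of_ne h₂ h₃
      have h₆ : -p < 2 * (a + k * p) := lt_of_le_of_ne h₁ h₄.symm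
      nlinarith
    choose f hf using key
    obtain ⟨δ, hδ₁, hδ₂, hδ₃, hδ₄⟩ : ∃ δ : Quaternion ℤ, δ.re = f x.re ∧ δ.imI = f x.imI ∧
        δ.imJ = f x.imJ ∧ δ.imK = f x.imK :=
      ⟨⟨f x.re, f x.imI, f x.imJ, f x.imK⟩, rfl, rfl, rfl, rfl⟩
    have hlt : normSq (x - p * δ : Quaternion ℤ) < (p : ℤ) ^ 2 := by
      have h := add_lt_add (add_lt_add (hf x.re) (hf x.imI)) (add_lt_add (hf x.imJ) (hf x.imK))
      have : normSq (x - p * δ : Quaternion ℤ) = (x.re - p * f x.re) ^ 2 + (x.imI - p * f x.imI) ^ 2 +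
          (x.imJ - p * f x.imJ) ^ 2 + (x.imK - p * f x.imK) ^ 2 := by
        rw [normSq_def']
        simp [hδ₁, hδ₂, hδ₃, hδ₄]
      rw [this]
      linarith
    have hxα : x * star (x - p * δ) = p * (N - x * star δ) := by
      have : x * star x = ((p * N : ℤ) : Quaternion ℤ) := by rw [self_mul_star, hN]; rfl
      rw [star_sub, star_mul, star_natCast, mul_sub, this, mul_sub, ← mul_assoc,
        (Nat.cast_commute p (x * star δ)).eq]
      push_cast
      rfl
    have hα0 : 0 < normSq (x - p * δ : Quaternion ℤ) := by
      refine normSq_nonneg.lt_of_ne fun h ↦ hdiv ⟨δ, ?_⟩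
      exact sub_eq_zero.1 (normSq_eq_zero.1 h.symm)
    have hdvd : (p : ℤ) ∣ normSq (x - p * δ : Quaternion ℤ) := by
      have h₂ : normSq (x - p * δ : Quaternion ℤ) = normSq x - p * (2 * (x * star δ).re) + p ^ 2 * normSq δ := by
        simp only [normSq_def']
        simp
        ring
      rw [h₂, hN]
      exact ⟨N - 2 * (x * star δ).re + p * normSq δ, by ring⟩
    obtain ⟨t, ht⟩ := hdvd
    have ht0 : 0 < t := pos_of_mul_pos_right (ht ▸ hα0) hp0.le
    have htp : t < p := by
      have : (p : ℤ) * t < p * p := by rw [← ht]; linarith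
      exact lt_of_mul_lt_mul_left this hp0.le
    lift t to ℕ using ht0.le
    exact exists_dvd_mul_star_of_lt hp hpo x t (by omega) (by omega) _ ht ⟨_, hxα⟩

end Quaternion

namespace Quaternion

/-- An integral quaternion congruent to `1` modulo `2` (coordinatewise). -/
def IsPrimary (x : Quaternion ℤ) : Prop :=
  Odd x.re ∧ Even x.imI ∧ Even x.imJ ∧ Even x.imK

lemma IsPrimary.mul {x y : Quaternion ℤ} (hx : x.IsPrimary) (hy : y.IsPrimary) :
    (x * y).IsPrimary := by
  obtain ⟨h₁, h₂, h₃, h₄⟩ := hx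
  obtain ⟨k₁, k₂, k₃, k₄⟩ := hy
  simp only [IsPrimary, re_mul, imI_mul, imJ_mul, imK_mul, ← Int.not_even_iff_odd] at *
  simp [Int.even_add, Int.even_sub, Int.even_mul, *]

lemma IsPrimary.star {x : Quaternion ℤ} (hx : x.IsPrimary) : (star x).IsPrimary := by
  obtain ⟨h₁, h₂, h₃, h₄⟩ := hx
  exact ⟨by simpa using h₁, by simpa using h₂, by simpa using h₃, by simpa using h₄⟩

lemma IsPrimary.neg {x : Quaternion ℤ} (hx : x.IsPrimary) : (-x).IsPrimary := by
  obtain ⟨h₁, h₂, h₃, h₄⟩ := hx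
  exact ⟨by simpa using h₁, by simpa using h₂, by simpa using h₃, by simpa using h₄⟩

lemma IsPrimary.odd_normSq {x : Quaternion ℤ} (hx : x.IsPrimary) :
    Odd (normSq x : ℤ) := by
  obtain ⟨h₁, h₂, h₃, h₄⟩ := hx
  rw [normSq_def']
  exact ((h₁.pow.add_even (h₂.pow_of_ne_zero two_ne_zero)).add_even
    (h₃.pow_of_ne_zero two_ne_zero)).add_even (h₄.pow_of_ne_zero two_ne_zero)

lemma IsPrimary.of_mul {x y : Quaternion ℤ} (hxy : (x * y).IsPrimary) (hy : y.IsPrimary) :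
    x.IsPrimary := by
  have h := hxy.mul hy.star
  have hodd := hy.odd_normSq
  rw [mul_assoc, self_mul_star, mul_coe_eq_smul] at h
  rw [← Int.not_even_iff_odd] at hodd
  simpa [IsPrimary, Int.odd_mul, Int.even_mul, hodd, Int.not_even_iff_odd.1 hodd] using h

/-- The basic units `1`, `i`, `j`, `k` of the Lipschitz order. -/
def basicUnit (n : Fin 4) : Quaternion ℤ :=
  ⟨if n = 0 then 1 else 0, if n = 1 then 1 else 0, if n = 2 then 1 else 0, if n = 3 then 1 else 0⟩

@[simp] lemma re_basicUnit (n : Fin 4) : (basicUnit n).re = if n = 0 then 1 else 0 := rfl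
@[simp] lemma imI_basicUnit (n : Fin 4) : (basicUnit n).imI = if n = 1 then 1 else 0 := rfl
@[simp] lemma imJ_basicUnit (n : Fin 4) : (basicUnit n).imJ = if n = 2 then 1 else 0 := rfl
@[simp] lemma imK_basicUnit (n : Fin 4) : (basicUnit n).imK = if n = 3 then 1 else 0 := rfl

lemma normSq_basicUnit (n : Fin 4) : normSq (basicUnit n) = 1 := by
  rw [normSq_def']
  fin_cases n <;> simp

lemma basicUnit_mul_star (n : Fin 4) : basicUnit n * star (basicUnit n) = 1 := by
  rw [self_mul_star, normSq_basicUnit]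
  rfl

lemma exists_isPrimary_star_basicUnit_mul {α : Quaternion ℤ} {p : ℕ} (hp : p % 4 = 1)
    (hα : normSq α = p) : ∃ n, (star (basicUnit n) * α).IsPrimary := by
  rw [normSq_def'] at hα
  have hp' : (p : ℤ) % 4 = 1 := by exact_mod_cast hp
  rw [← hα] at hp'
  have key : ∀ a : ℤ, (Even a ∧ a ^ 2 % 4 = 0) ∨ (Odd a ∧ a ^ 2 % 4 = 1) := fun a ↦ by
    rcases Int.even_or_odd a with h | h
    · exact .inl ⟨h, by obtain ⟨b, rfl⟩ := h; ring_nf; omega⟩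
    · exact .inr ⟨h, by obtain ⟨b, rfl⟩ := h; ring_nf; omega⟩
  have hu : (Odd α.re ∧ Even α.imI ∧ Even α.imJ ∧ Even α.imK) ∨
      (Even α.re ∧ Odd α.imI ∧ Even α.imJ ∧ Even α.imK) ∨
      (Even α.re ∧ Even α.imI ∧ Odd α.imJ ∧ Even α.imK) ∨
      (Even α.re ∧ Even α.imI ∧ Even α.imJ ∧ Odd α.imK) := by
    have h₁ := key α.re
    have h₂ := key α.imI
    have h₃ := key α.imJ
    have h₄ := key α.imK
    generalize α.re ^ 2 = A at *
    generalize α.imI ^ 2 = B at *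
    generalize α.imJ ^ 2 = C at *
    generalize α.imK ^ 2 = D at *
    simp only [Int.even_iff, Int.odd_iff] at *
    clear key hα
    rcases h₁ with ⟨h₁, k₁⟩ | ⟨h₁, k₁⟩ <;> rcases h₂ with ⟨h₂, k₂⟩ | ⟨h₂, k₂⟩ <;>
    rcases h₃ with ⟨h₃, k₃⟩ | ⟨h₃, k₃⟩ <;> rcases h₄ with ⟨h₄, k₄⟩ | ⟨h₄, k₄⟩ <;>
    omega
  rcases hu with ⟨h₁, h₂, h₃, h₄⟩ | ⟨h₁, h₂, h₃, h₄⟩ | ⟨h₁, h₂, h₃, h₄⟩ | ⟨h₁, h₂, h₃, h₄⟩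
  · exact ⟨0, by simp [IsPrimary, re_mul, imI_mul, imJ_mul, imK_mul, *]⟩
  · exact ⟨1, by simp [IsPrimary, re_mul, imI_mul, imJ_mul, imK_mul, *]⟩
  · exact ⟨2, by simp [IsPrimary, re_mul, imI_mul, imJ_mul, imK_mul, *]⟩
  · exact ⟨3, by simp [IsPrimary, re_mul, imI_mul, imJ_mul, imK_mul, *]⟩

/-- Conjugation by a basic unit preserves primary quaternions. -/
lemma IsPrimary.conj_basicUnit {x : Quaternion ℤ} (hx : x.IsPrimary) (n : Fin 4) :
    (basicUnit n * x * Star.star (basicUnit n)).IsPrimary := by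
  obtain ⟨h₁, h₂, h₃, h₄⟩ := hx
  fin_cases n <;>
  simp [IsPrimary, re_mul, imI_mul, imJ_mul, imK_mul, *]

/-- A primary quaternion of norm `p ^ (h + 1)` has a primary right divisor of norm `p`. -/
theorem IsPrimary.exists_eq_mul {p h : ℕ} (hp : p.Prime) (hp4 : p % 4 = 1) {x : Quaternion ℤ}
    (hx : x.IsPrimary) (hN : normSq x = (p : ℤ) ^ (h + 1)) :
    ∃ y α : Quaternion ℤ, x = y * α ∧ y.IsPrimary ∧ α.IsPrimary ∧ normSq y = (p : ℤ) ^ h ∧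
      normSq α = p := by
  obtain ⟨y, α, rfl, hα⟩ := exists_eq_mul_of_dvd_normSq hp (Nat.odd_iff.2 (by omega)) x
    (hN ▸ dvd_pow_self _ (by omega))
  obtain ⟨n, hn⟩ := exists_isPrimary_star_basicUnit_mul hp4 hα
  have hmul : y * α = y * basicUnit n * (Star.star (basicUnit n) * α) := by
    rw [mul_assoc, ← mul_assoc (basicUnit n), basicUnit_mul_star, one_mul]
  refine ⟨_, _, hmul, IsPrimary.of_mul (hmul ▸ hx) hn, hn, ?_, ?_⟩
  · rw [map_mul, hα, pow_succ] at hN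
    rw [map_mul, normSq_basicUnit, mul_one]
    exact mul_right_cancel₀ (by exact_mod_cast hp.ne_zero) hN
  · rw [map_mul, normSq_star, normSq_basicUnit, one_mul, hα]

section Matrix

variable {R : Type*} [CommRing R]

/-- The matrix attached to an integral quaternion by a square root `i` of `-1`. -/
def toMatrix (i : R) (x : Quaternion ℤ) : Matrix (Fin 2) (Fin 2) R :=
  !![(x.re : R) + i * (x.imI : R), (x.imJ : R) + i * (x.imK : R);
    -(x.imJ : R) + i * (x.imK : R), (x.re : R) - i * (x.imI : R)]

variable {i : R}

lemma toMatrix_mul (hi : i ^ 2 = -1) (x y : Quaternion ℤ) :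
    toMatrix i (x * y) = toMatrix i x * toMatrix i y := by
  simp only [toMatrix, re_mul, imI_mul, imJ_mul, imK_mul, Matrix.mul_fin_two]
  congr! 1
  ext a b
  fin_cases a <;> fin_cases b <;> simp
  · linear_combination -(x.imI * y.imI + x.imK * y.imK : R) * hi
  · linear_combination -(x.imI * y.imK - x.imK * y.imI : R) * hi
  · linear_combination -(x.imK * y.imI - x.imI * y.imK : R) * hi
  · linear_combination -(x.imI * y.imI + x.imK * y.imK : R) * hi

lemma toMatrix_one : toMatrix i 1 = 1 := by
  ext a b
  fin_cases a <;> fin_cases b <;> simp [toMatrix]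

lemma toMatrix_neg (x : Quaternion ℤ) : toMatrix i (-x) = -toMatrix i x := by
  ext a b
  fin_cases a <;> fin_cases b <;> simp [toMatrix] <;> ring

lemma det_toMatrix (hi : i ^ 2 = -1) (x : Quaternion ℤ) :
    (toMatrix i x).det = (normSq x : ℤ) := by
  rw [toMatrix, Matrix.det_fin_two_of, normSq_def']
  push_cast
  linear_combination -((x.imI : R) ^ 2 + (x.imK : R) ^ 2) * hi

lemma det_smul_toMatrix (hi : i ^ 2 = -1) {w : R} {p h : ℕ} (hw : w ^ 2 * p = 1)
    {x : Quaternion ℤ} (hx : normSq x = (p : ℤ) ^ h) : (w ^ h • toMatrix i x).det = 1 := by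
  rw [Matrix.det_smul, det_toMatrix hi, hx, Fintype.card_fin]
  push_cast
  rw [← pow_mul, mul_comm h, pow_mul, ← mul_pow, hw, one_pow]

lemma coe_inv_eq_smul_toMatrix_star {w : R} {x : Quaternion ℤ}
    {A : Matrix.SpecialLinearGroup (Fin 2) R}
    (hA : (A : Matrix (Fin 2) (Fin 2) R) = w • toMatrix i x) :
    ((A⁻¹ : Matrix.SpecialLinearGroup (Fin 2) R) : Matrix (Fin 2) (Fin 2) R) =
      w • toMatrix i (star x) := by
  rw [Matrix.SpecialLinearGroup.coe_inv, hA, Matrix.adjugate_fin_two]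
  ext a b
  fin_cases a <;> fin_cases b <;> simp [toMatrix] <;> ring

/-- The image in `SL₂(R)` of the primary quaternions of `p`-power norm. -/
def primarySubgroup (hi : i ^ 2 = -1) (w : R) (p : ℕ) :
    Subgroup (Matrix.SpecialLinearGroup (Fin 2) R) where
  carrier := {A | ∃ (h : ℕ) (x : Quaternion ℤ), x.IsPrimary ∧ normSq x = (p : ℤ) ^ h ∧
    (A : Matrix (Fin 2) (Fin 2) R) = w ^ h • toMatrix i x}
  mul_mem' := by
    rintro A B ⟨h, x, hx, hN, hA⟩ ⟨h', x', hx', hN', hB⟩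
    refine ⟨h + h', x * x', hx.mul hx', by rw [map_mul, hN, hN', pow_add], ?_⟩
    refine (Matrix.SpecialLinearGroup.coe_mul A B).trans ?_
    rw [hA, hB, toMatrix_mul hi, smul_mul_smul_comm, pow_add]
  one_mem' := ⟨0, 1, by simp [IsPrimary], by simp, by simp [toMatrix_one]⟩
  inv_mem' := by
    rintro A ⟨h, x, hx, hN, hA⟩
    exact ⟨h, Star.star x, hx.star, by rw [normSq_star, hN], coe_inv_eq_smul_toMatrix_star hA⟩

lemma exists_mem_primarySubgroup (hi : i ^ 2 = -1) {w : R} {p h : ℕ} (hw : w ^ 2 * p = 1)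
    (hwh : w ^ h = 1) {x : Quaternion ℤ} (hx : x.IsPrimary) (hN : normSq x = (p : ℤ) ^ h) :
    ∃ A ∈ primarySubgroup hi w p, (A : Matrix (Fin 2) (Fin 2) R) = toMatrix i x := by
  have hdet := det_smul_toMatrix hi hw hN
  have hmat : w ^ h • toMatrix i x = toMatrix i x := by rw [hwh, one_smul]
  exact ⟨⟨_, hdet⟩, ⟨h, x, hx, hN, rfl⟩, hmat⟩

lemma trace_toMatrix (x : Quaternion ℤ) : (toMatrix i x).trace = (2 * x.re : ℤ) := by
  rw [toMatrix, Matrix.trace_fin_two_of]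
  push_cast
  ring

lemma toMatrix_intCast_add (t : ℤ) (x : Quaternion ℤ) :
    toMatrix i (t + x) = (t : R) • (1 : Matrix (Fin 2) (Fin 2) R) + toMatrix i x := by
  ext a b
  fin_cases a <;> fin_cases b <;> simp [toMatrix] <;> ring

end Matrix

end Quaternion

namespace Matrix.SpecialLinearGroup

variable {R : Type*} [CommRing R]

/-- If every unimodular column can be shortened, a subgroup of `SL₂(R)` containing the elementary
matrices is everything. -/
theorem eq_top_of_elementary_mem
    (hR : ∀ a b c d : R, a * d - b * c = 1 → ∃ j, IsUnit (c + j * a))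
    (K : Subgroup (Matrix.SpecialLinearGroup (Fin 2) R))
    (hU : ∀ (j : R) (A : Matrix.SpecialLinearGroup (Fin 2) R),
      (A : Matrix (Fin 2) (Fin 2) R) = !![1, j; 0, 1] → A ∈ K)
    (hL : ∀ (j : R) (A : Matrix.SpecialLinearGroup (Fin 2) R),
      (A : Matrix (Fin 2) (Fin 2) R) = !![1, 0; j, 1] → A ∈ K) : K = ⊤ := by
  obtain ⟨U, hUc⟩ : ∃ U : R → Matrix.SpecialLinearGroup (Fin 2) R,
      ∀ j, (U j : Matrix (Fin 2) (Fin 2) R) = !![1, j; 0, 1] :=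
    ⟨fun j ↦ ⟨!![1, j; 0, 1], by simp⟩, fun j ↦ rfl⟩
  obtain ⟨L, hLc⟩ : ∃ L : R → Matrix.SpecialLinearGroup (Fin 2) R,
      ∀ j, (L j : Matrix (Fin 2) (Fin 2) R) = !![1, 0; j, 1] :=
    ⟨fun j ↦ ⟨!![1, 0; j, 1], by simp⟩, fun j ↦ rfl⟩
  have hU' (j : R) : U j ∈ K := hU j _ (hUc j)
  have hL' (j : R) : L j ∈ K := hL j _ (hLc j)
  have key (g : Matrix.SpecialLinearGroup (Fin 2) R) (hg : IsUnit (g 1 0)) : g ∈ K := by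
    obtain ⟨c, hc⟩ := hg.exists_left_inv
    have hdet := g.det_coe
    rw [Matrix.det_fin_two] at hdet
    have : g = U ((g 0 0 - 1) * c) * L (g 1 0) * U ((g 1 1 - 1) * c) := by
      ext x y
      rw [coe_mul, coe_mul, hUc, hLc, hUc]
      fin_cases x <;> fin_cases y <;> simp [Matrix.mul_apply, Fin.sum_univ_two]
      · linear_combination -(g 0 0 - 1) * hc
      · linear_combination -c * hdet - (g 0 1 + (g 0 0 - 1) * (g 1 1 - 1) * c) * hc
      · linear_combination -(g 1 1 - 1) * hc
    rw [this]
    exact K.mul_mem (K.mul_mem (hU' _) (hL' _)) (hU' _)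
  refine (Subgroup.eq_top_iff' K).2 fun g ↦ ?_
  have hdet := g.det_coe
  rw [Matrix.det_fin_two] at hdet
  obtain ⟨j, hj⟩ := hR _ _ _ _ hdet
  refine (K.mul_mem_cancel_left (hL' j)).1 (key _ ?_)
  rw [coe_mul, hLc]
  simpa [Matrix.mul_apply, Fin.sum_univ_two, add_comm] using hj

end Matrix.SpecialLinearGroup

namespace Matrix

variable {R : Type*} [CommRing R]

lemma mul_mul_self_eq_trace_smul {e : Matrix (Fin 2) (Fin 2) R} (he : e.det = 0)
    (X : Matrix (Fin 2) (Fin 2) R) : e * X * e = (X * e).trace • e := by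
  rw [det_fin_two] at he
  ext a b
  fin_cases a <;> fin_cases b <;> simp [Matrix.mul_apply, Fin.sum_univ_two, trace_fin_two]
  · linear_combination -(X 1 1) * he
  · linear_combination (X 0 1) * he
  · linear_combination (X 1 0) * he
  · linear_combination -(X 0 0) * he

/-- The algebra endomorphism of `M₂(R)` sending the standard matrix units to those generated by
`e` and `f`. -/
def matrixUnitsMap (e f X : Matrix (Fin 2) (Fin 2) R) : Matrix (Fin 2) (Fin 2) R :=
  X 0 0 • (e * f) + X 0 1 • e + X 1 0 • f + X 1 1 • (f * e)

variable {e f : Matrix (Fin 2) (Fin 2) R}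

lemma matrixUnitsMap_mul (he : e * e = 0) (hf : f * f = 0) (hef : e * f + f * e = 1)
    (X Y : Matrix (Fin 2) (Fin 2) R) :
    matrixUnitsMap e f (X * Y) = matrixUnitsMap e f X * matrixUnitsMap e f Y := by
  have he' (Z) : e * (e * Z) = 0 := by rw [← mul_assoc, he, zero_mul]
  have hf' (Z) : f * (f * Z) = 0 := by rw [← mul_assoc, hf, zero_mul]
  have hefe : e * (f * e) = e := by
    rw [eq_sub_iff_add_eq'.2 hef, mul_sub, mul_one, he', sub_zero]
  have hfef : f * (e * f) = f := by
    rw [eq_sub_iff_add_eq.2 hef, mul_sub, mul_one, hf', sub_zero]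
  simp only [matrixUnitsMap, add_mul, mul_add, smul_mul_assoc, mul_smul_comm, mul_assoc, he, hf,
    he', hf', hefe, hfef, smul_zero, mul_zero, Matrix.mul_apply, Fin.sum_univ_two]
  module

lemma matrixUnitsMap_smul (r : R) (X : Matrix (Fin 2) (Fin 2) R) :
    matrixUnitsMap e f (r • X) = r • matrixUnitsMap e f X := by
  simp only [matrixUnitsMap, Matrix.smul_apply, smul_add, smul_smul, smul_eq_mul]

lemma matrixUnitsMap_one (hef : e * f + f * e = 1) : matrixUnitsMap e f 1 = 1 := by
  simp [matrixUnitsMap, hef]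

lemma matrixUnitsMap_adjugate (he : e.trace = 0) (hf : f.trace = 0)
    (X : Matrix (Fin 2) (Fin 2) R) :
    matrixUnitsMap e f X.adjugate = (matrixUnitsMap e f X).adjugate := by
  rw [trace_fin_two, add_eq_zero_iff_eq_neg] at he hf
  ext a b
  fin_cases a <;> fin_cases b <;>
  simp [matrixUnitsMap, adjugate_fin_two, Matrix.mul_apply, Fin.sum_univ_two, he, hf] <;> ring

lemma det_matrixUnitsMap (he : e * e = 0) (hf : f * f = 0) (hef : e * f + f * e = 1)
    (het : e.trace = 0) (hft : f.trace = 0) (X : Matrix (Fin 2) (Fin 2) R) :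
    (matrixUnitsMap e f X).det = X.det := by
  have h := congrArg (matrixUnitsMap e f) X.mul_adjugate
  rw [matrixUnitsMap_mul he hf hef, matrixUnitsMap_adjugate het hft, mul_adjugate,
    matrixUnitsMap_smul, matrixUnitsMap_one hef] at h
  simpa using congrFun (congrFun h 0) 0

lemma exists_matrixUnitsMap_eq (hef : e * f + f * e = 1) (he : e.det = 0) (hf : f.det = 0)
    (hee : e * e = 0) (hff : f * f = 0)
    (g : Matrix (Fin 2) (Fin 2) R) : ∃ X, matrixUnitsMap e f X = g := by
  have hefe : e * f * e = e := by
    rw [eq_sub_iff_add_eq.2 hef, sub_mul, one_mul, mul_assoc f, hee, mul_zero, sub_zero]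
  have hfef : f * e * f = f := by
    rw [eq_sub_iff_add_eq'.2 hef, sub_mul, one_mul, mul_assoc e, hff, mul_zero, sub_zero]
  refine ⟨!![(f * g * e).trace, (g * f).trace; (g * e).trace, (e * g * f).trace], ?_⟩
  simp only [matrixUnitsMap, of_apply, cons_val', cons_val_zero, cons_val_one, cons_val_fin_one]
  have h₁ : (f * g * e).trace • (e * f) = e * (f * g) * e * f := by
    rw [mul_mul_self_eq_trace_smul he, smul_mul_assoc]
  have h₂ : (g * f).trace • e = e * (f * g * f) * e := by
    rw [mul_mul_self_eq_trace_smul hf, mul_smul_comm, smul_mul_assoc, hefe]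
  have h₃ : (g * e).trace • f = f * (e * g * e) * f := by
    rw [mul_mul_self_eq_trace_smul he, mul_smul_comm, smul_mul_assoc, hfef]
  have h₄ : (e * g * f).trace • (f * e) = f * (e * g) * f * e := by
    rw [mul_mul_self_eq_trace_smul hf, smul_mul_assoc]
  rw [h₁, h₂, h₃, h₄]
  calc _ = (e * f + f * e) * g * (e * f + f * e) := by noncomm_ring
    _ = g := by rw [hef, one_mul, mul_one]

namespace SpecialLinearGroup

/-- A subgroup of `SL₂(R)` containing a transvection group `1 + R e` and an element `g` with
`tr (g e)` a unit is everything. -/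
theorem eq_top_of_one_add_smul_mem
    (hR : ∀ a b c d : R, a * d - b * c = 1 → ∃ j, IsUnit (c + j * a))
    (H : Subgroup (Matrix.SpecialLinearGroup (Fin 2) R)) (he : e.det = 0) (het : e.trace = 0)
    (hH : ∀ (j : R) (A : Matrix.SpecialLinearGroup (Fin 2) R),
      (A : Matrix (Fin 2) (Fin 2) R) = 1 + j • e → A ∈ H)
    {g : Matrix.SpecialLinearGroup (Fin 2) R} (hg : g ∈ H)
    (hu : IsUnit ((g : Matrix (Fin 2) (Fin 2) R) * e).trace) : H = ⊤ := by
  obtain ⟨t, ht⟩ := hu.exists_left_inv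
  set G : Matrix (Fin 2) (Fin 2) R := ↑g with hG
  have hGG : G.adjugate * G = 1 := by rw [adjugate_mul, g.det_coe, one_smul]
  have hGG' : G * G.adjugate = 1 := by rw [mul_adjugate, g.det_coe, one_smul]
  set f : Matrix (Fin 2) (Fin 2) R := -t ^ 2 • (G * e * G.adjugate) with hfdef
  have hee : e * e = 0 := by simpa [het] using mul_mul_self_eq_trace_smul he 1
  have hff : f * f = 0 := by
    have : G * e * G.adjugate * (G * e * G.adjugate) = G * (e * e) * G.adjugate := by
      calc _ = G * e * (G.adjugate * G) * e * G.adjugate := by noncomm_ring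
        _ = _ := by rw [hGG]; noncomm_ring
    rw [hfdef, smul_mul_smul_comm, this, hee, mul_zero, zero_mul, smul_zero]
  have hft : f.trace = 0 := by
    rw [hfdef, trace_smul, trace_mul_comm, ← mul_assoc, hGG, one_mul, het, smul_zero]
  have hfd : f.det = 0 := by
    rw [hfdef, det_smul, det_mul, det_mul, he, mul_zero, zero_mul, mul_zero]
  have hef : e * f + f * e = 1 := by
    have hadj : (G.adjugate * e).trace = -(G * e).trace := by
      rw [trace_fin_two, add_eq_zero_iff_eq_neg] at het
      rw [adjugate_fin_two, trace_fin_two, trace_fin_two]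
      simp only [Matrix.mul_apply, Fin.sum_univ_two, of_apply, cons_val', cons_val_zero,
        cons_val_one, cons_val_fin_one, het]
      ring
    have htr : (e * f).trace = 1 := by
      rw [hfdef, mul_smul_comm, trace_smul, ← mul_assoc, ← mul_assoc, mul_mul_self_eq_trace_smul he,
        smul_mul_assoc, trace_smul, trace_mul_comm e, hadj, smul_eq_mul, smul_eq_mul]
      linear_combination (t * (G * e).trace + 1) * ht
    rw [trace_fin_two, add_eq_zero_iff_eq_neg] at het hft
    simp only [trace_fin_two, Matrix.mul_apply, Fin.sum_univ_two, het, hft] at htr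
    ext a b
    fin_cases a <;> fin_cases b <;> simp [Matrix.mul_apply, Fin.sum_univ_two, het, hft]
    · linear_combination htr
    · ring
    · ring
    · linear_combination htr
  let Ψ : Matrix.SpecialLinearGroup (Fin 2) R →* Matrix.SpecialLinearGroup (Fin 2) R :=
    { toFun X := ⟨matrixUnitsMap e f X, by
        rw [det_matrixUnitsMap hee hff hef het hft, X.det_coe]⟩
      map_one' := Subtype.ext (matrixUnitsMap_one hef)
      map_mul' X Y := Subtype.ext (matrixUnitsMap_mul hee hff hef X Y) }
  have hΨ (X) : (Ψ X : Matrix (Fin 2) (Fin 2) R) = matrixUnitsMap e f X := rfl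
  have hK : H.comap Ψ = ⊤ := by
    refine eq_top_of_elementary_mem hR _ (fun j A hA ↦ hH j _ ?_) fun j A hA ↦ ?_
    · rw [hΨ, hA, ← hef, matrixUnitsMap]
      simp
      abel
    · have hmem : g⁻¹ * Ψ A * g ∈ H := by
        refine hH (-t ^ 2 * j) _ ?_
        have h : (Ψ A : Matrix (Fin 2) (Fin 2) R) = 1 + j • f := by
          rw [hΨ, hA, ← hef, matrixUnitsMap]
          simp
          abel
        rw [coe_mul, coe_mul, coe_inv, h, ← hG, hfdef, mul_add, add_mul, mul_one, hGG, smul_smul,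
          mul_smul_comm, smul_mul_assoc, mul_comm j]
        congr 2
        calc G.adjugate * (G * e * G.adjugate) * G
          _ = (G.adjugate * G) * e * (G.adjugate * G) := by noncomm_ring
          _ = e := by rw [hGG, one_mul, mul_one]
      have := H.mul_mem (H.mul_mem hg hmem) (H.inv_mem hg)
      rw [Subgroup.mem_comap]
      convert this using 1
      group
  refine (Subgroup.eq_top_iff' H).2 fun A ↦ ?_
  obtain ⟨X, hX⟩ := exists_matrixUnitsMap_eq hef he hfd hee hff (A : Matrix (Fin 2) (Fin 2) R)
  have hdet : X.det = 1 := by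
    rw [← det_matrixUnitsMap hee hff hef het hft, hX, A.det_coe]
  obtain ⟨Y, hY⟩ : ∃ Y : Matrix.SpecialLinearGroup (Fin 2) R,
      (Y : Matrix (Fin 2) (Fin 2) R) = X := ⟨⟨X, hdet⟩, rfl⟩
  have hYA : Ψ Y = A := Subtype.ext (by rw [hΨ, hY, hX])
  have hmem : Y ∈ H.comap Ψ := hK ▸ Subgroup.mem_top Y
  exact hYA ▸ hmem

end SpecialLinearGroup

end Matrix

lemma exists_sq_add_four_mul_sum_sq_eq_pow {p m : ℕ} (hp : 1 < p) (hp2 : Odd p)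
    (hpm : p.Coprime m) (hm : m % 4 = 1) :
    ∃ (h : ℕ) (a b c a' b' c' : ℤ), m.totient ∣ h ∧
      (1 + 2 * m) ^ 2 + 4 * (a ^ 2 + b ^ 2 + c ^ 2) = (p : ℤ) ^ h ∧
      (m : ℤ) ∣ a ^ 2 + b ^ 2 + c ^ 2 ∧ a * a' + b * b' + c * c' = 1 := by
  have hcop : p.Coprime (16 * m) :=
    (Nat.Coprime.pow_right 4 (Nat.coprime_two_right.2 hp2) : p.Coprime (2 ^ 4)).mul_right hpm
  have hm0 : 0 < m := by omega
  have hpos : 0 < (16 * m).totient := Nat.totient_pos.2 (by omega)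
  have hP : 1 < p ^ (16 * m).totient := Nat.one_lt_pow hpos.ne' hp
  obtain ⟨z, hz⟩ := (Nat.modEq_iff_dvd' hP.le).1 (Nat.ModEq.pow_totient hcop).symm
  have hz0 : 0 < z := by
    rcases Nat.eq_zero_or_pos z with rfl | h
    · omega
    · exact h
  have hPz : p ^ (16 * m).totient = 1 + 16 * m * z := by omega
  obtain ⟨r, hr⟩ : ∃ r, 8 * z + 64 * (m * z ^ 2) = 1 + m + r :=
    Nat.exists_eq_add_of_le (by nlinarith [Nat.mul_le_mul_left m (Nat.one_le_pow 2 z hz0)])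
  have hr2 : r % 4 = 2 := by omega
  obtain ⟨a, b, c, a', b', c', h₁, h₂⟩ := exists_primitive_sum_three_squares
    (n := m * r) (by rw [Nat.mul_mod, hm, hr2])
  refine ⟨(16 * m).totient * 2, a, b, c, a', b', c',
    (Nat.totient_dvd_of_dvd (Dvd.intro_left 16 rfl)).mul_right 2, ?_, ?_, h₂⟩
  · rw [h₁, pow_mul, ← Nat.cast_pow, hPz]
    have hr' : (8 * z + 64 * (m * z ^ 2) : ℤ) = 1 + m + r := by exact_mod_cast hr
    push_cast
    linear_combination -4 * m * hr'
  · rw [h₁]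
    exact ⟨r, by push_cast; ring⟩

section TwoPrimes

variable {m l q k : ℕ}

lemma ZMod.isUnit_intCast_of_eq_mul_pow (hl : l.Prime) (hq : q.Prime) (hm : m = l * q ^ k) {z : ℤ}
    (h₁ : ¬ (l : ℤ) ∣ z) (h₂ : ¬ (q : ℤ) ∣ z) : IsUnit (z : ZMod m) := by
  rw [ZMod.coe_int_isUnit_iff_isCoprime, hm]
  push_cast
  exact (((Nat.prime_iff_prime_int.1 hl).coprime_iff_not_dvd.2 h₁).mul_left
    (((Nat.prime_iff_prime_int.1 hq).coprime_iff_not_dvd.2 h₂).pow_left))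

lemma ZMod.exists_isUnit_add_mul (hl : l.Prime) (hq : q.Prime) (hk : k ≠ 0) (hm : m = l * q ^ k)
    (a b c d : ZMod m) (h : a * d - b * c = 1) : ∃ j, IsUnit (c + j * a) := by
  obtain ⟨a, rfl⟩ := ZMod.intCast_surjective a
  obtain ⟨b, rfl⟩ := ZMod.intCast_surjective b
  obtain ⟨c, rfl⟩ := ZMod.intCast_surjective c
  obtain ⟨d, rfl⟩ := ZMod.intCast_surjective d
  have hdvd : (m : ℤ) ∣ a * d - b * c - 1 := by
    rw [← ZMod.intCast_zmod_eq_zero_iff_dvd]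
    push_cast
    rw [h, sub_self]
  have hlp := Nat.prime_iff_prime_int.1 hl
  have hqp := Nat.prime_iff_prime_int.1 hq
  have key (r : ℕ) (hr : Prime (r : ℤ)) (hrm : r ∣ m) (hrc : (r : ℤ) ∣ c) : ¬ (r : ℤ) ∣ a := by
    intro hra
    refine hr.not_dvd_one ?_
    have h₁ := (Int.natCast_dvd_natCast.2 hrm).trans hdvd
    have h₂ : (r : ℤ) ∣ a * d - b * c := dvd_sub (hra.mul_right d) (hrc.mul_left b)
    simpa using dvd_sub h₂ h₁
  have kl := key l hlp (hm ▸ Dvd.intro _ rfl)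
  have kq := key q hqp (hm ▸ (dvd_pow_self q hk).mul_left l)
  have unit (j : ℤ) (h₁ : ¬ (l : ℤ) ∣ c + j * a) (h₂ : ¬ (q : ℤ) ∣ c + j * a) :
      ∃ j : ZMod m, IsUnit ((c : ZMod m) + j * a) :=
    ⟨j, by exact_mod_cast ZMod.isUnit_intCast_of_eq_mul_pow hl hq hm h₁ h₂⟩
  have hne {r s : ℕ} (hr : r.Prime) (hs : s.Prime) (h₁ : (r : ℤ) ∣ c) (h₂ : ¬ (s : ℤ) ∣ c) :
      ¬ (r : ℤ) ∣ s := by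
    rw [Int.natCast_dvd_natCast, Nat.prime_dvd_prime_iff_eq hr hs]
    rintro rfl
    exact h₂ h₁
  by_cases h₁ : (l : ℤ) ∣ c <;> by_cases h₂ : (q : ℤ) ∣ c
  · refine unit 1 ?_ ?_
    · rw [dvd_add_right h₁, one_mul]
      exact kl h₁
    · rw [dvd_add_right h₂, one_mul]
      exact kq h₂
  · refine unit q ?_ ?_
    · rw [dvd_add_right h₁, hlp.dvd_mul, not_or]
      exact ⟨hne hl hq h₁ h₂, kl h₁⟩
    · rwa [dvd_add_left (Dvd.intro _ rfl)]
  · refine unit l ?_ ?_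
    · rwa [dvd_add_left (Dvd.intro _ rfl)]
    · rw [dvd_add_right h₂, hqp.dvd_mul, not_or]
      exact ⟨hne hq hl h₂ h₁, kq h₂⟩
  · refine unit 0 ?_ ?_ <;> simpa

/-- If some `T n` is prime to `l` and some `T n'` is prime to `q`, then either some `T n` is
prime to both, or the two can be combined. -/
lemma exists_not_dvd_combination (hl : l.Prime) (hq : q.Prime) {ι : Type*} {T : ι → ℤ}
    (h₁ : ∃ n, ¬ (l : ℤ) ∣ T n) (h₂ : ∃ n, ¬ (q : ℤ) ∣ T n) :
    ∃ (n n' : ι) (j j' : ℤ), ∀ r, ¬ (l : ℤ) ∣ j * T n + j' * T n' + j * j' * r ∧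
      ¬ (q : ℤ) ∣ j * T n + j' * T n' + j * j' * r := by
  obtain ⟨n, hn⟩ := h₁
  obtain ⟨n', hn'⟩ := h₂
  have hlp := Nat.prime_iff_prime_int.1 hl
  have hqp := Nat.prime_iff_prime_int.1 hq
  by_cases hnq : (q : ℤ) ∣ T n
  · by_cases hnl : (l : ℤ) ∣ T n'
    · have hlq : l ≠ q := by
        rintro rfl
        exact hn hnq
      refine ⟨n, n', q, l, fun r ↦ ⟨?_, ?_⟩⟩
      · rw [add_assoc, dvd_add_left ⟨T n' + q * r, by ring⟩, hlp.dvd_mul, not_or,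
          Int.natCast_dvd_natCast, Nat.prime_dvd_prime_iff_eq hl hq]
        exact ⟨hlq, hn⟩
      · rw [add_right_comm, dvd_add_right ⟨T n + l * r, by ring⟩, hqp.dvd_mul, not_or,
          Int.natCast_dvd_natCast, Nat.prime_dvd_prime_iff_eq hq hl]
        exact ⟨hlq.symm, hn'⟩
    · exact ⟨n', n', 1, 0, fun r ↦ by simp [hnl, hn']⟩
  · exact ⟨n, n, 1, 0, fun r ↦ by simp [hnq, hn]⟩

end TwoPrimes

lemma Matrix.SpecialLinearGroup.mem_of_eq_one_add_smul {m : ℕ} [NeZero m]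
    {H : Subgroup (Matrix.SpecialLinearGroup (Fin 2) (ZMod m))}
    {e : Matrix (Fin 2) (Fin 2) (ZMod m)} (he : e * e = 0)
    {B : Matrix.SpecialLinearGroup (Fin 2) (ZMod m)} (hB : B ∈ H)
    (hBe : (B : Matrix (Fin 2) (Fin 2) (ZMod m)) = 1 + e) (j : ZMod m)
    {A : Matrix.SpecialLinearGroup (Fin 2) (ZMod m)}
    (hA : (A : Matrix (Fin 2) (Fin 2) (ZMod m)) = 1 + j • e) : A ∈ H := by
  have hpow (n : ℕ) : (1 + e) ^ n = 1 + n • e := by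
    induction n with
    | zero => simp
    | succ n ih =>
      rw [pow_succ, ih, add_mul, mul_add, smul_mul_assoc, mul_add, he, succ_nsmul, mul_one,
        mul_one, one_mul, add_zero]
      abel
  have hAB : A = B ^ j.val := by
    refine Subtype.ext (hA.trans ?_)
    rw [coe_pow, hBe, hpow, ← Nat.cast_smul_eq_nsmul (ZMod m), ZMod.natCast_zmod_val]
  exact hAB ▸ H.pow_mem hB _

lemma Matrix.det_one_add_smul_of_fin_two {R : Type*} [CommRing R] {e : Matrix (Fin 2) (Fin 2) R}
    (he : e.det = 0) (het : e.trace = 0) (j : R) : (1 + j • e).det = 1 := by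
  rw [det_fin_two] at he ⊢
  rw [trace_fin_two] at het
  simp
  linear_combination j * het + j ^ 2 * he

namespace Quaternion

theorem primarySubgroup_eq_top {m l q k p : ℕ} (hl : l.Prime) (hq : q.Prime) (hk : k ≠ 0)
    (hm : m = l * q ^ k) (hm4 : m % 4 = 1) (hp : p.Prime) (hp2 : Odd p) (hpm : p.Coprime m)
    {i w : ZMod m} (hi : i ^ 2 = -1) (hw : w ^ 2 * p = 1) : primarySubgroup hi w p = ⊤ := by
  have : NeZero m := ⟨by omega⟩
  have hlp := Nat.prime_iff_prime_int.1 hl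
  have hqp := Nat.prime_iff_prime_int.1 hq
  have hodd {r : ℕ} (hr : r.Prime) (hrm : r ∣ m) : ¬ (r : ℤ) ∣ 16 := by
    intro h
    have h2 : r ∣ 2 ^ 4 := by exact_mod_cast h
    rw [(Nat.prime_dvd_prime_iff_eq hr Nat.prime_two).1 (hr.dvd_of_dvd_pow h2)] at hrm
    omega
  obtain ⟨h, a, b, c, a', b', c', hφ, hN, hdvd, hprim⟩ :=
    exists_sq_add_four_mul_sum_sq_eq_pow hp.one_lt hp2 hpm hm4
  obtain ⟨v, hv₀, hv₁, hv₂, hv₃⟩ : ∃ v : Quaternion ℤ,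
    v.re = 0 ∧ v.imI = 2 * a ∧ v.imJ = 2 * b ∧ v.imK = 2 * c := ⟨⟨0, 2 * a, 2 * b, 2 * c⟩, by simp⟩
  have hwh : w ^ h = 1 := by
    obtain ⟨u, rfl⟩ : IsUnit w := IsUnit.of_mul_eq_one (w * p) (by linear_combination hw)
    obtain ⟨g, rfl⟩ := hφ
    rw [pow_mul, ← Units.val_pow_eq_pow_val, ZMod.pow_totient, Units.val_one, one_pow]
  have hS : (a ^ 2 + b ^ 2 + c ^ 2 : ZMod m) = 0 := by
    exact_mod_cast (ZMod.intCast_zmod_eq_zero_iff_dvd _ _).2 hdvd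
  have hNv : normSq v = 4 * (a ^ 2 + b ^ 2 + c ^ 2) := by
    rw [normSq_def', hv₀, hv₁, hv₂, hv₃]
    ring
  obtain ⟨t, ht⟩ : ∃ t : ℤ, t = 1 + 2 * m := ⟨_, rfl⟩
  set x : Quaternion ℤ := (t : Quaternion ℤ) + v with hx
  have hxr : x.re = t ∧ x.imI = 2 * a ∧ x.imJ = 2 * b ∧ x.imK = 2 * c := by
    rw [hx]
    simp [hv₀, hv₁, hv₂, hv₃]
  obtain ⟨hx₀, hx₁, hx₂, hx₃⟩ := hxr
  have hxp : x.IsPrimary := by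
    rw [IsPrimary, hx₀, hx₁, hx₂, hx₃]
    exact ⟨⟨m, by rw [ht]; ring⟩, even_two_mul _, even_two_mul _, even_two_mul _⟩
  have hxN : normSq x = (p : ℤ) ^ h := by
    rw [normSq_def', hx₀, hx₁, hx₂, hx₃, ← hN, ht]
    ring
  set V : Fin 4 → Quaternion ℤ := fun n ↦ basicUnit n * v * star (basicUnit n) with hV
  have hVt (n : Fin 4) : (toMatrix i (V n)).trace = 0 := by
    have : (V n).re = 0 := by
      fin_cases n <;> simp [hV, hv₀]
    rw [trace_toMatrix, this, mul_zero, Int.cast_zero]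
  have hVd (n : Fin 4) : (toMatrix i (V n)).det = 0 := by
    rw [det_toMatrix hi, hV, map_mul, map_mul, normSq_star, normSq_basicUnit, one_mul, mul_one,
      hNv]
    push_cast
    rw [hS, mul_zero]
  have hVe (n : Fin 4) : toMatrix i (V n) * toMatrix i (V n) = 0 := by
    simpa [hVt n] using Matrix.mul_mul_self_eq_trace_smul (hVd n) 1
  have hVH (n : Fin 4) (j : ZMod m) (A : Matrix.SpecialLinearGroup (Fin 2) (ZMod m))
      (hA : (A : Matrix (Fin 2) (Fin 2) (ZMod m)) = 1 + j • toMatrix i (V n)) :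
      A ∈ primarySubgroup hi w p := by
    have hconj : basicUnit n * x * star (basicUnit n) =
        (t : Quaternion ℤ) + V n := by
      rw [hx, mul_add, add_mul, ← Int.cast_comm, mul_assoc (Int.cast _), basicUnit_mul_star,
        mul_one]
    obtain ⟨B, hB, hBe⟩ := exists_mem_primarySubgroup hi hw hwh (hxp.conj_basicUnit n)
      (by rw [map_mul, map_mul, normSq_star, normSq_basicUnit, hxN, one_mul, mul_one])
    rw [hconj, toMatrix_intCast_add] at hBe
    exact Matrix.SpecialLinearGroup.mem_of_eq_one_add_smul (hVe n) hB 
      (hBe.trans (by simp [ht])) j hA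
  have hV0 : V 0 = v := by
    ext <;> simp [hV]
  have htr (n : Fin 3) : (toMatrix i (V n.succ) * toMatrix i v).trace =
      ((-16 * (![a, b, c] n) ^ 2 : ℤ) : ZMod m) := by
    rw [← toMatrix_mul hi, trace_toMatrix]
    have : (V n.succ * v).re = -8 * (![a, b, c] n) ^ 2 + 4 * (a ^ 2 + b ^ 2 + c ^ 2) := by
      fin_cases n <;> simp [hV, hv₀, hv₁, hv₂, hv₃] <;> ring
    rw [this]
    push_cast
    rw [hS]
    ring
  have hT {r : ℕ} (hr : r.Prime) (hrm : r ∣ m) :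
      ∃ n, ¬ (r : ℤ) ∣ -16 * (![a, b, c] n) ^ 2 := by
    have hrp := Nat.prime_iff_prime_int.1 hr
    by_contra! hcon
    have hcoord (n) : (r : ℤ) ∣ ![a, b, c] n := by
      have := hcon n
      rw [neg_mul, dvd_neg, hrp.dvd_mul, or_iff_right (hodd hr hrm)] at this
      exact hrp.dvd_of_dvd_pow this
    refine hrp.not_dvd_one (hprim ▸ ?_)
    exact dvd_add (dvd_add ((hcoord 0).mul_right a') ((hcoord 1).mul_right b'))
      ((hcoord 2).mul_right c')
  obtain ⟨n, n', j, j', hjj⟩ := exists_not_dvd_combination hl hq (hT hl (hm ▸ Dvd.intro _ rfl))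
    (hT hq (hm ▸ (dvd_pow_self q hk).mul_left l))
  have hunip (n : Fin 4) (j : ZMod m) : ∃ A ∈ primarySubgroup hi w p,
      (A : Matrix (Fin 2) (Fin 2) (ZMod m)) = 1 + j • toMatrix i (V n) :=
    ⟨⟨_, Matrix.det_one_add_smul_of_fin_two (hVd n) (hVt n) j⟩, hVH n j _ rfl, rfl⟩
  obtain ⟨A, hA, hAe⟩ := hunip n.succ j
  obtain ⟨B, hB, hBe⟩ := hunip n'.succ j'
  rw [← hV0] at htr
  refine Matrix.SpecialLinearGroup.eq_top_of_one_add_smul_mem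
    (ZMod.exists_isUnit_add_mul hl hq hk hm) _ (hVd 0) (hVt 0) (hVH 0)
    ((primarySubgroup hi w p).mul_mem hA hB) ?_
  obtain ⟨r, hr⟩ := ZMod.intCast_surjective
    (toMatrix i (V n.succ) * toMatrix i (V n'.succ) * toMatrix i (V 0)).trace
  convert ZMod.isUnit_intCast_of_eq_mul_pow hl hq hm (hjj r).1 (hjj r).2
  rw [Matrix.SpecialLinearGroup.coe_mul, hAe, hBe, add_mul, one_mul, smul_mul_assoc, mul_add,
    mul_one, mul_smul_comm]
  simp only [add_mul, one_mul, smul_mul_assoc, Matrix.trace_add, Matrix.trace_smul, hVt, htr, ← hr,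
    smul_add]
  push_cast
  simp only [smul_eq_mul]
  ring

end Quaternion

namespace SimpleGraph

variable {Q : Type*} [Group Q] {S : Set Q}

lemma fromRel_mul_connected (hS : Subgroup.closure S = ⊤) :
    (SimpleGraph.fromRel fun x y : Q ↦ ∃ a ∈ S, y = x * a).Connected := by
  set X := SimpleGraph.fromRel fun x y : Q ↦ ∃ a ∈ S, y = x * a with hX
  have key : ∀ g ∈ Subgroup.closure S, ∀ x, X.Reachable x (x * g) := by
    intro g hg
    induction hg using Subgroup.closure_induction with
    | mem a ha =>
      intro x
      by_cases hxa : x = x * a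
      · rw [← hxa]
      · exact Adj.reachable ((fromRel_adj _ _ _).2 ⟨hxa, .inl ⟨a, ha, rfl⟩⟩)
    | one => intro x; rw [mul_one]
    | mul a b _ _ ha hb => intro x; rw [← mul_assoc]; exact (ha x).trans (hb _)
    | inv a _ ha => intro x; simpa using (ha (x * a⁻¹)).symm
  refine (connected_iff_exists_forall_reachable _).2 ⟨1, fun g ↦ ?_⟩
  simpa using key g (hS ▸ Subgroup.mem_top g) 1

lemma fromRel_mul_walk_induction {P : ℕ → Q → Prop}
    (hmul : ∀ d x, P d x → ∀ a ∈ S, P (d + 1) (x * a))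
    (hinv : ∀ d x, P d x → ∀ a ∈ S, P (d + 1) (x * a⁻¹)) {x y : Q}
    (W : (SimpleGraph.fromRel fun x y : Q ↦ ∃ a ∈ S, y = x * a).Walk x y) (d : ℕ) (h : P d x) :
    P (d + W.length) y := by
  induction W generalizing d with
  | nil => exact h
  | cons hadj W ih =>
    rw [Walk.length_cons, add_comm W.length, ← add_assoc]
    refine ih _ ?_
    obtain ⟨-, ⟨a, ha, rfl⟩ | ⟨a, ha, rfl⟩⟩ := (fromRel_adj _ _ _).1 hadj
    · exact hmul _ _ h a ha
    · simpa using hinv _ _ h a ha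

end SimpleGraph

namespace Quaternion

variable {R : Type*} [CommRing R] {i w : R} {p : ℕ}

/-- The generators of the Lubotzky–Phillips–Sarnak graph, in `PSL₂(R)`. -/
def lpsGenerators (i w : R) (p : ℕ) : Set (Matrix.SpecialLinearGroup (Fin 2) R ⧸
    Subgroup.center (Matrix.SpecialLinearGroup (Fin 2) R)) :=
  {g | ∃ (A : Matrix.SpecialLinearGroup (Fin 2) R) (α : Quaternion ℤ), g = QuotientGroup.mk A ∧
    normSq α = p ∧ 0 < α.re ∧ α.IsPrimary ∧ (A : Matrix (Fin 2) (Fin 2) R) = w • toMatrix i α}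

lemma IsPrimary.re_ne_zero {x : Quaternion ℤ} (hx : x.IsPrimary) : x.re ≠ 0 :=
  fun h ↦ absurd (h ▸ hx.1 : Odd (0 : ℤ)) (by decide)

lemma IsPrimary.eq_one_or_neg_one {x : Quaternion ℤ} (hx : x.IsPrimary) (hN : normSq x = (1 : ℤ)) :
    x = 1 ∨ x = -1 := by
  rw [normSq_def'] at hN
  have h : 0 < x.re ^ 2 := sq_pos_of_ne_zero hx.re_ne_zero
  have h₁ := sq_nonneg x.imI
  have h₂ := sq_nonneg x.imJ
  have h₃ := sq_nonneg x.imK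
  have hI : x.imI = 0 := pow_eq_zero_iff two_ne_zero |>.1 (by omega)
  have hJ : x.imJ = 0 := pow_eq_zero_iff two_ne_zero |>.1 (by omega)
  have hK : x.imK = 0 := pow_eq_zero_iff two_ne_zero |>.1 (by omega)
  rcases (sq_eq_sq_iff_eq_or_eq_neg (a := x.re) (b := 1)).1 (by omega) with h | h
  · exact .inl (by ext <;> simp [h, hI, hJ, hK])
  · exact .inr (by ext <;> simp [h, hI, hJ, hK])

lemma mk_mem_closure_lpsGenerators (hi : i ^ 2 = -1) (hw : w ^ 2 * p = 1) (hp : p.Prime)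
    (hp4 : p % 4 = 1) (h : ℕ) : ∀ (x : Quaternion ℤ) (A : Matrix.SpecialLinearGroup (Fin 2) R),
      x.IsPrimary → normSq x = (p : ℤ) ^ h →
      (A : Matrix (Fin 2) (Fin 2) R) = w ^ h • toMatrix i x →
      (QuotientGroup.mk A : Matrix.SpecialLinearGroup (Fin 2) R ⧸
        Subgroup.center (Matrix.SpecialLinearGroup (Fin 2) R)) ∈
        Subgroup.closure (lpsGenerators i w p) := by
  induction h with
  | zero =>
    intro x A hx hN hA
    have hone : (QuotientGroup.mk A : Matrix.SpecialLinearGroup (Fin 2) R ⧸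
        Subgroup.center (Matrix.SpecialLinearGroup (Fin 2) R)) = 1 := by
      rw [QuotientGroup.eq_one_iff, Matrix.SpecialLinearGroup.mem_center_iff]
      rcases hx.eq_one_or_neg_one (by simpa using hN) with rfl | rfl
      · exact ⟨1, by simp, by simp [hA, toMatrix_one]⟩
      · exact ⟨-1, by simp, by simp [hA, toMatrix_one, toMatrix_neg, ← Matrix.diagonal_neg]⟩
    rw [hone]
    exact Subgroup.one_mem _
  | succ h ih =>
    intro x A hx hN hA
    obtain ⟨y, α, rfl, hy, hα, hNy, hNα, hpos⟩ : ∃ y α : Quaternion ℤ, x = y * α ∧ y.IsPrimary ∧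
        α.IsPrimary ∧ normSq y = (p : ℤ) ^ h ∧ normSq α = p ∧ 0 < α.re := by
      obtain ⟨y, α, rfl, hy, hα, hNy, hNα⟩ := hx.exists_eq_mul hp hp4 hN
      rcases hα.re_ne_zero.lt_or_gt with h0 | h0
      · exact ⟨-y, -α, by simp, hy.neg, hα.neg, by simpa using hNy, by simpa using hNα,
          by simpa using h0⟩
      · exact ⟨y, α, rfl, hy, hα, hNy, hNα, h0⟩
    obtain ⟨B, hB⟩ : ∃ B : Matrix.SpecialLinearGroup (Fin 2) R,
        (B : Matrix (Fin 2) (Fin 2) R) = w ^ h • toMatrix i y :=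
      ⟨⟨_, det_smul_toMatrix hi hw hNy⟩, rfl⟩
    obtain ⟨C, hC⟩ : ∃ C : Matrix.SpecialLinearGroup (Fin 2) R,
        (C : Matrix (Fin 2) (Fin 2) R) = w ^ 1 • toMatrix i α :=
      ⟨⟨_, det_smul_toMatrix hi hw (by rw [hNα, pow_one])⟩, rfl⟩
    have hABC : A = B * C := by
      refine Subtype.ext (hA.trans ?_)
      rw [Matrix.SpecialLinearGroup.coe_mul, hB, hC, toMatrix_mul hi, smul_mul_smul_comm, pow_succ,
        pow_one]
    rw [hABC, QuotientGroup.mk_mul]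
    refine Subgroup.mul_mem _ (ih y B hy hNy hB) (Subgroup.subset_closure ?_)
    exact ⟨C, α, rfl, hNα, hpos, hα, by rw [hC, pow_one]⟩

theorem closure_lpsGenerators_eq_top (hi : i ^ 2 = -1) (hw : w ^ 2 * p = 1) (hp : p.Prime)
    (hp4 : p % 4 = 1) (htop : primarySubgroup hi w p = ⊤) :
    Subgroup.closure (lpsGenerators i w p) = ⊤ := by
  refine (Subgroup.eq_top_iff' _).2 fun g ↦ ?_
  obtain ⟨A, rfl⟩ := QuotientGroup.mk_surjective g
  obtain ⟨h, x, hx, hN, hA⟩ : A ∈ primarySubgroup hi w p := htop ▸ Subgroup.mem_top A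
  exact mk_mem_closure_lpsGenerators hi hw hp hp4 h x A hx hN hA

/-- An element at distance `d` from the identity is represented by a quaternion of norm `p ^ d`. -/
lemma exists_eq_mk_of_walk (hi : i ^ 2 = -1)
    {g : Matrix.SpecialLinearGroup (Fin 2) R ⧸
      Subgroup.center (Matrix.SpecialLinearGroup (Fin 2) R)}
    (W : (SimpleGraph.fromRel fun x y ↦ ∃ a ∈ lpsGenerators i w p, y = x * a).Walk 1 g) :
    ∃ (A : Matrix.SpecialLinearGroup (Fin 2) R) (x : Quaternion ℤ), g = QuotientGroup.mk A ∧
      normSq x = (p : ℤ) ^ W.length ∧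
      (A : Matrix (Fin 2) (Fin 2) R) = w ^ W.length • toMatrix i x := by
  have step (d : ℕ) (A B : Matrix.SpecialLinearGroup (Fin 2) R) (x y : Quaternion ℤ)
      (hx : normSq x = (p : ℤ) ^ d) (hy : normSq y = p)
      (hA : (A : Matrix (Fin 2) (Fin 2) R) = w ^ d • toMatrix i x)
      (hB : (B : Matrix (Fin 2) (Fin 2) R) = w • toMatrix i y) :
      normSq (x * y) = (p : ℤ) ^ (d + 1) ∧
      ((A * B : Matrix.SpecialLinearGroup (Fin 2) R) : Matrix (Fin 2) (Fin 2) R) =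
        w ^ (d + 1) • toMatrix i (x * y) := by
    refine ⟨by rw [map_mul, hx, hy, pow_succ], ?_⟩
    rw [Matrix.SpecialLinearGroup.coe_mul, hA, hB, toMatrix_mul hi, smul_mul_smul_comm, pow_succ]
  have := SimpleGraph.fromRel_mul_walk_induction (P := fun d g ↦
    ∃ (A : Matrix.SpecialLinearGroup (Fin 2) R) (x : Quaternion ℤ), g = QuotientGroup.mk A ∧
      normSq x = (p : ℤ) ^ d ∧ (A : Matrix (Fin 2) (Fin 2) R) = w ^ d • toMatrix i x) ?_ ?_ W 0
      ⟨1, 1, rfl, by simp, by simp [toMatrix_one]⟩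
  · rwa [zero_add] at this
  · rintro d _ ⟨A, x, rfl, hx, hA⟩ _ ⟨B, y, rfl, hy, -, -, hB⟩
    obtain ⟨h₁, h₂⟩ := step d A B x y hx hy hA hB
    exact ⟨A * B, x * y, rfl, h₁, h₂⟩
  · rintro d _ ⟨A, x, rfl, hx, hA⟩ _ ⟨B, y, rfl, hy, -, -, hB⟩
    obtain ⟨h₁, h₂⟩ := step d A B⁻¹ x (star y) hx (by rw [normSq_star, hy]) hA
      (coe_inv_eq_smul_toMatrix_star hB)
    exact ⟨A * B⁻¹, x * star y, rfl, h₁, h₂⟩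

/-- If the graph has diameter `D`, every element of `SL₂` is up to scalars the reduction of a
quaternion of norm `p ^ d` with `d ≤ D`. -/
theorem exists_toMatrix_eq_smul [Finite R] (hi : i ^ 2 = -1) (hw : w ^ 2 * p = 1)
    (htop : Subgroup.closure (lpsGenerators i w p) = ⊤)
    (A : Matrix.SpecialLinearGroup (Fin 2) R) :
    ∃ d ≤ (SimpleGraph.fromRel fun x y ↦ ∃ a ∈ lpsGenerators i w p, y = x * a).diam,
      ∃ (x : Quaternion ℤ) (r : R), normSq x = (p : ℤ) ^ d ∧ IsUnit r ∧
        toMatrix i x = r • (A : Matrix (Fin 2) (Fin 2) R) := by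
  have hconn := SimpleGraph.fromRel_mul_connected htop
  have : Finite (Matrix.SpecialLinearGroup (Fin 2) R) := Subtype.finite
  obtain ⟨W, hW⟩ := hconn.exists_walk_length_eq_dist 1 (QuotientGroup.mk A)
  obtain ⟨B, x, hAB, hN, hB⟩ := exists_eq_mk_of_walk hi W
  rw [hW] at hN hB
  rw [QuotientGroup.eq, Matrix.SpecialLinearGroup.mem_center_iff] at hAB
  obtain ⟨r, hr, hrA⟩ := hAB
  have hd := SimpleGraph.dist_le_diam (SimpleGraph.connected_iff_ediam_ne_top.1 hconn)
    (u := 1) (v := QuotientGroup.mk A)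
  generalize (SimpleGraph.fromRel fun x y ↦ ∃ a ∈ lpsGenerators i w p, y = x * a).dist 1
    (QuotientGroup.mk A) = d at *
  have hwp : (w * p) * w = 1 := by linear_combination hw
  refine ⟨d, hd, x, (w * p) ^ d * r, hN, ?_, ?_⟩
  · refine (IsUnit.of_mul_eq_one _ hwp).pow d |>.mul ?_
    rw [Fintype.card_fin] at hr
    exact IsUnit.of_mul_eq_one r (by rw [← hr, sq])
  · have hBA : (B : Matrix (Fin 2) (Fin 2) R) = r • (A : Matrix (Fin 2) (Fin 2) R) := by
      have h : (B : Matrix (Fin 2) (Fin 2) R) =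
          (A : Matrix (Fin 2) (Fin 2) R) * ((A⁻¹ * B : Matrix.SpecialLinearGroup (Fin 2) R) :
            Matrix (Fin 2) (Fin 2) R) := by
        rw [← Matrix.SpecialLinearGroup.coe_mul, mul_inv_cancel_left]
      rw [h, ← hrA, Matrix.scalar_apply, ← Matrix.smul_one_eq_diagonal, mul_smul_comm, mul_one]
    rw [mul_smul, ← hBA, hB, smul_smul, ← mul_pow, hwp, one_pow, one_smul]

end Quaternion

lemma eq_pow_mul_of_sq_add_eq_pow {p q k h j : ℕ} (hp : p.Prime) (hq : q.Prime) (hq2 : q ≠ 2)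
    (hqp : q ≠ p) (hk : k ≠ 0) {x x' N N' : ℤ} (hN : 0 ≤ N) (hN' : 0 ≤ N')
    (h₁ : x ^ 2 + ((q : ℤ) ^ k) ^ 2 * N = (p : ℤ) ^ h)
    (h₂ : x' ^ 2 + ((q : ℤ) ^ k) ^ 2 * N' = (p : ℤ) ^ (h + 2 * j))
    (hlt : 4 * p ^ (h + 2 * j) < (q ^ k) ^ 4) : N' = (p : ℤ) ^ (2 * j) * N := by
  have hqi := Nat.prime_iff_prime_int.1 hq
  have hQ0 : 0 < (q : ℤ) ^ k := by exact_mod_cast pow_pos hq.pos k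
  set Q : ℤ := (q : ℤ) ^ k with hQ
  set X : ℤ := (p : ℤ) ^ j * x with hX
  have h₃ : X ^ 2 + Q ^ 2 * ((p : ℤ) ^ (2 * j) * N) = (p : ℤ) ^ (h + 2 * j) := by
    rw [pow_add, ← h₁, hX]
    ring
  have hM : 0 ≤ (p : ℤ) ^ (2 * j) * N := by positivity
  generalize (p : ℤ) ^ (2 * j) * N = M at *
  have hlt' : 4 * (p : ℤ) ^ (h + 2 * j) < Q ^ 4 := by
    rw [hQ]
    exact_mod_cast hlt
  have hqX : ¬ (q : ℤ) ∣ X := by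
    intro hX
    have : (q : ℤ) ∣ (p : ℤ) ^ (h + 2 * j) := by
      rw [← h₃, hQ]
      exact dvd_add (dvd_pow hX two_ne_zero)
        (((dvd_pow_self _ hk).trans (dvd_pow_self _ two_ne_zero)).mul_right M)
    have h' : q ∣ p := by exact_mod_cast hqi.dvd_of_dvd_pow this
    exact hqp ((Nat.prime_dvd_prime_iff_eq hq hp).1 h')
  have hprod : (q : ℤ) ^ (k * 2) ∣ (X - x') * (X + x') :=
    ⟨N' - M, by rw [pow_mul, ← hQ]; linear_combination h₃ - h₂⟩
  have hbound (y : ℤ) (hy : y ^ 2 ≤ 4 * (p : ℤ) ^ (h + 2 * j)) (hdvd : (q : ℤ) ^ (k * 2) ∣ y) :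
      y = 0 := by
    refine Int.eq_zero_of_abs_lt_dvd hdvd (abs_lt_of_sq_lt_sq ?_ (by positivity))
    rw [pow_mul, ← hQ]
    nlinarith
  have hsq : X ^ 2 = x' ^ 2 := by
    have hX1 : X ^ 2 ≤ (p : ℤ) ^ (h + 2 * j) := by nlinarith [mul_nonneg (sq_nonneg Q) hM]
    have hX2 : x' ^ 2 ≤ (p : ℤ) ^ (h + 2 * j) := by nlinarith [mul_nonneg (sq_nonneg Q) hN']
    by_cases hsub : (q : ℤ) ∣ X - x'
    · have hadd : ¬ (q : ℤ) ∣ X + x' := by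
        intro hadd
        have h2X : (q : ℤ) ∣ 2 * X := by
          have := dvd_add hsub hadd
          rwa [show X - x' + (X + x') = 2 * X by ring] at this
        rcases hqi.dvd_or_dvd h2X with h2 | h2
        · have h2' : q ∣ 2 := by exact_mod_cast h2
          exact hq2 ((Nat.prime_dvd_prime_iff_eq hq Nat.prime_two).1 h2')
        · exact hqX h2
      have := hbound (X - x') (by nlinarith [sq_nonneg (X + x')])
        (hqi.pow_dvd_of_dvd_mul_right _ hadd hprod)
      rw [sub_eq_zero.1 this]
    · have := hbound (X + x') (by nlinarith [sq_nonneg (X - x')])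
        (hqi.pow_dvd_of_dvd_mul_left _ hsub hprod)
      rw [eq_neg_of_add_eq_zero_left this, neg_sq]
  have : Q ^ 2 * (N' - M) = 0 := by linear_combination h₂ - h₃ + hsq
  rcases mul_eq_zero.1 this with h | h
  · exact absurd h (by positivity)
  · linarith

lemma exists_eq_mul_of_dvd_two_mul_sub {l Q x T : ℤ} (hQ : Odd Q) (hQ0 : Q ≠ 0)
    (h : l * Q ∣ 2 * x - Q * T) : ∃ y, x = Q * y ∧ l ∣ 2 * y - T := by
  have h2 : Q ∣ 2 * x := by
    have := dvd_add (dvd_of_mul_left_dvd h) (Dvd.intro T rfl)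
    rwa [sub_add_cancel] at this
  obtain ⟨y, rfl⟩ := (Int.isCoprime_two_right.2 hQ).dvd_of_dvd_mul_left h2
  refine ⟨y, rfl, ?_⟩
  rw [mul_comm l, show 2 * (Q * y) - Q * T = Q * (2 * y - T) by ring] at h
  exact Int.dvd_of_mul_dvd_mul_left hQ0 h

namespace Quaternion

lemma exists_normSq_eq_of_toMatrix_eq {m Q : ℕ} (hQ : Odd Q) (hm : m = 5 * Q) {i r : ZMod m}
    (hi : i ^ 2 = -1) (hr : IsUnit r) {x : Quaternion ℤ} {A D : ZMod m} {B C E : ℤ}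
    (hAD : A - D = Q * E)
    (hx : toMatrix i x = r • !![A, (Q * B : ZMod m); (Q * C : ZMod m), D]) :
    ∃ N : ℤ, 0 ≤ N ∧ x.re ^ 2 + (Q : ℤ) ^ 2 * N = normSq x ∧ (5 ∣ N ↔ 5 ∣ E ^ 2 + 4 * B * C) ∧
      (¬ 5 ∣ B - C → N ≠ 0) := by
  obtain ⟨I, rfl⟩ := ZMod.intCast_surjective i
  obtain ⟨S, rfl⟩ := ZMod.intCast_surjective r
  have hmZ : (m : ℤ) = 5 * Q := by exact_mod_cast hm
  have e₀₀ := congrFun (congrFun hx 0) 0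
  have e₀₁ := congrFun (congrFun hx 0) 1
  have e₁₀ := congrFun (congrFun hx 1) 0
  have e₁₁ := congrFun (congrFun hx 1) 1
  simp only [toMatrix, Matrix.of_apply, Matrix.cons_val', Matrix.cons_val_zero, Matrix.cons_val_one,
    Matrix.cons_val_fin_one, Matrix.smul_apply, smul_eq_mul] at e₀₀ e₀₁ e₁₀ e₁₁
  have key (y T : ℤ) (h : (2 * y - Q * T : ZMod m) = 0) :
      ∃ z, y = Q * z ∧ (5 : ℤ) ∣ 2 * z - T := by
    refine exists_eq_mul_of_dvd_two_mul_sub (by exact_mod_cast hQ)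
      (by exact_mod_cast hQ.pos.ne') ?_
    rw [← hmZ, ← ZMod.intCast_zmod_eq_zero_iff_dvd]
    exact_mod_cast h
  obtain ⟨y₁, hy₁, z₁, hz₁⟩ := key x.imI (-I * S * E) (by
    push_cast
    linear_combination -I * (e₀₀ - e₁₁) - I * S * hAD + 2 * x.imI * hi)
  obtain ⟨y₂, hy₂, z₂, hz₂⟩ := key x.imJ (S * (B - C)) (by
    push_cast
    linear_combination e₀₁ - e₁₀)
  obtain ⟨y₃, hy₃, z₃, hz₃⟩ := key x.imK (-I * S * (B + C)) (by
    push_cast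
    linear_combination -I * (e₀₁ + e₁₀) + 2 * x.imK * hi)
  obtain ⟨c, hc⟩ : (5 : ℤ) ∣ I ^ 2 + 1 := by
    have : (m : ℤ) ∣ I ^ 2 + 1 := by
      rw [← ZMod.intCast_zmod_eq_zero_iff_dvd]
      push_cast
      rw [hi, neg_add_cancel]
    exact (hmZ ▸ Dvd.intro _ rfl : (5 : ℤ) ∣ m).trans this
  have h5 : Prime (5 : ℤ) := by norm_num
  have hS : ¬ (5 : ℤ) ∣ S := by
    intro h
    rw [ZMod.coe_int_isUnit_iff_isCoprime, hmZ] at hr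
    exact h5.not_isUnit ((hr.of_mul_left_left).isUnit_of_dvd' dvd_rfl h)
  refine ⟨y₁ ^ 2 + y₂ ^ 2 + y₃ ^ 2, by positivity, ?_, ?_, ?_⟩
  · rw [normSq_def', hy₁, hy₂, hy₃]
    ring
  · have hsum : (5 : ℤ) ∣ 4 * (y₁ ^ 2 + y₂ ^ 2 + y₃ ^ 2) + S ^ 2 * (E ^ 2 + 4 * B * C) :=
      ⟨z₁ * (2 * y₁ - I * S * E) + z₂ * (2 * y₂ + S * (B - C)) +
        z₃ * (2 * y₃ - I * S * (B + C)) + c * (S ^ 2 * E ^ 2 + S ^ 2 * (B + C) ^ 2), by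
        linear_combination (2 * y₁ - I * S * E) * hz₁ + (2 * y₂ + S * (B - C)) * hz₂ +
          (2 * y₃ - I * S * (B + C)) * hz₃ + (S ^ 2 * E ^ 2 + S ^ 2 * (B + C) ^ 2) * hc⟩
    have hS2 : ¬ (5 : ℤ) ∣ S ^ 2 := fun h ↦ hS (h5.dvd_of_dvd_pow h)
    constructor
    · intro h
      exact (h5.dvd_or_dvd ((dvd_add_right (h.mul_left 4)).1 hsum)).resolve_left hS2
    · intro h
      exact (h5.dvd_or_dvd ((dvd_add_left (h.mul_left _)).1 hsum)).resolve_left (by norm_num)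
  · intro hBC h0
    have hy : y₂ = 0 := by
      have h : y₂ ^ 2 = 0 := by nlinarith [sq_nonneg y₁, sq_nonneg y₂, sq_nonneg y₃]
      exact pow_eq_zero_iff two_ne_zero |>.1 h
    have : (5 : ℤ) ∣ S * (B - C) := ⟨-z₂, by rw [hy] at hz₂; linear_combination -hz₂⟩
    exact (h5.dvd_or_dvd this).elim hS hBC

/-- If every element of `SL₂(ℤ/5q^k)` is up to scalars the reduction of a quaternion of norm
`p ^ d` with `d ≤ D`, then `q ^ (4 k) ≤ 4 p ^ D`. -/
theorem pow_le_four_mul_pow {p q k m D : ℕ} (hp : p.Prime) (hq : q.Prime) (hq2 : q ≠ 2)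
    (hk : k ≠ 0) (hm : m = 5 * q ^ k) (hcop : p.Coprime m) {i : ZMod m} (hi : i ^ 2 = -1)
    (hD : ∀ A : Matrix.SpecialLinearGroup (Fin 2) (ZMod m), ∃ d ≤ D,
      ∃ (x : Quaternion ℤ) (r : ZMod m), normSq x = (p : ℤ) ^ d ∧ IsUnit r ∧
        toMatrix i x = r • (A : Matrix (Fin 2) (Fin 2) (ZMod m))) :
    (q ^ k) ^ 4 ≤ 4 * p ^ D := by
  by_contra! hlt
  have hlt' {d : ℕ} (hd : d ≤ D) : 4 * p ^ d < (q ^ k) ^ 4 :=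
    (Nat.mul_le_mul_left 4 (Nat.pow_le_pow_right hp.pos hd)).trans_lt hlt
  have hQ : Odd (q ^ k) := (hq.odd_of_ne_two hq2).pow
  have hqp : q ≠ p := by
    rintro rfl
    have := Nat.Coprime.coprime_dvd_right (hm ▸ (dvd_pow_self q hk).mul_left 5 : q ∣ m) hcop
    exact hq.one_lt.ne' ((Nat.coprime_self q).1 this)
  have hp5 : ¬ (5 : ℤ) ∣ p := by
    intro h
    have h' : 5 ∣ p := by exact_mod_cast h
    have := Nat.Coprime.eq_one_of_dvd (hcop.symm.coprime_dvd_left (hm ▸ Dvd.intro _ rfl)) h'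
    omega
  have h5 : Prime (5 : ℤ) := by norm_num
  have hodd {d : ℕ} (hd : d ≤ D) {x N : ℤ} (hN : 0 ≤ N) (hN0 : N ≠ 0)
      (h : x ^ 2 + ((q ^ k : ℕ) : ℤ) ^ 2 * N = (p : ℤ) ^ d) : Odd d := by
    rw [← Nat.not_even_iff_odd]
    rintro ⟨j, rfl⟩
    rw [← two_mul, ← zero_add (2 * j)] at h hd
    push_cast at h
    have h0 := eq_pow_mul_of_sq_add_eq_pow (x := 1) (N := 0) hp hq hq2 hqp hk le_rfl hN
      (by simp) h (hlt' hd)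
    exact hN0 (h0.trans (mul_zero _))
  obtain ⟨d₁, hd₁, x₁, r₁, hx₁, hr₁, he₁⟩ := hD ⟨!![1, ((q ^ k : ℕ) : ZMod m) * (1 : ℤ);
    ((q ^ k : ℕ) : ZMod m) * (0 : ℤ), 1], by simp⟩
  obtain ⟨N₁, hN₁, hs₁, h5₁, h0₁⟩ := exists_normSq_eq_of_toMatrix_eq hQ hm hi hr₁ (E := 0)
    (by simp) he₁
  obtain ⟨d₂, hd₂, x₂, r₂, hx₂, hr₂, he₂⟩ := hD ⟨!![1 + 2 * ((q ^ k : ℕ) : ZMod m) ^ 2,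
    ((q ^ k : ℕ) : ZMod m) * (1 : ℤ); ((q ^ k : ℕ) : ZMod m) * (2 : ℤ), 1], by
      rw [Matrix.det_fin_two_of]; push_cast; ring⟩
  obtain ⟨N₂, hN₂, hs₂, h5₂, h0₂⟩ := exists_normSq_eq_of_toMatrix_eq hQ hm hi hr₂
    (E := 2 * ((q ^ k : ℕ) : ℤ)) (by push_cast; ring) he₂
  replace h5₁ : (5 : ℤ) ∣ N₁ := h5₁.2 (by norm_num)
  replace h0₁ : N₁ ≠ 0 := h0₁ (by norm_num)
  replace h5₂ : ¬ (5 : ℤ) ∣ N₂ := by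
    rw [h5₂]
    generalize ((q ^ k : ℕ) : ℤ) = Q
    intro h
    have h' : (5 : ℤ) ∣ Q ^ 2 + 2 := by
      refine (h5.dvd_or_dvd (a := 4) ?_).resolve_left (by norm_num)
      rwa [show 4 * (Q ^ 2 + 2) = (2 * Q) ^ 2 + 4 * 1 * 2 by ring]
    have h3 : Q % 5 = 0 ∨ Q % 5 = 1 ∨ Q % 5 = 2 ∨ Q % 5 = 3 ∨ Q % 5 = 4 := by omega
    rcases h3 with h3 | h3 | h3 | h3 | h3 <;>
      simp [Int.dvd_iff_emod_eq_zero, Int.add_emod, pow_two, Int.mul_emod, h3] at h'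
  have h0₂' : N₂ ≠ 0 := by
    rintro rfl
    exact h5₂ (dvd_zero 5)
  rw [hx₁] at hs₁
  rw [hx₂] at hs₂
  obtain ⟨j₁, hj₁⟩ := hodd hd₁ hN₁ h0₁ hs₁
  obtain ⟨j₂, hj₂⟩ := hodd hd₂ hN₂ h0₂' hs₂
  push_cast at hs₁ hs₂
  rcases le_total d₁ d₂ with h | h
  · obtain ⟨j, rfl⟩ : ∃ j, d₂ = d₁ + 2 * j := ⟨j₂ - j₁, by omega⟩
    have := eq_pow_mul_of_sq_add_eq_pow hp hq hq2 hqp hk hN₁ hN₂ hs₁ hs₂ (hlt' hd₂)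
    exact h5₂ (this ▸ h5₁.mul_left _)
  · obtain ⟨j, rfl⟩ : ∃ j, d₁ = d₂ + 2 * j := ⟨j₁ - j₂, by omega⟩
    have := eq_pow_mul_of_sq_add_eq_pow hp hq hq2 hqp hk hN₂ hN₁ hs₂ hs₁ (hlt' hd₁)
    rcases h5.dvd_or_dvd (this ▸ h5₁) with h' | h'
    · exact hp5 (h5.dvd_of_dvd_pow h')
    · exact h5₂ h'

end Quaternion

namespace Matrix.SpecialLinearGroup

variable {R : Type*} [CommRing R]

/-- Since a matrix of determinant one is determined by its first column up to an upper unipotent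
factor, `SL₂(R)` has at most `|R|` elements for every possible first column. -/
lemma card_le_mul_card [Finite R] (s : Set (R × R))
    (hs : ∀ g : Matrix.SpecialLinearGroup (Fin 2) R, (g 0 0, g 1 0) ∈ s) :
    Nat.card (Matrix.SpecialLinearGroup (Fin 2) R) ≤ s.ncard * Nat.card R := by
  classical
  have hex (c : s) : ∃ g : Matrix.SpecialLinearGroup (Fin 2) R,
      ∀ h : Matrix.SpecialLinearGroup (Fin 2) R, h 0 0 = c.1.1 → h 1 0 = c.1.2 →
        g 0 0 = c.1.1 ∧ g 1 0 = c.1.2 := by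
    by_cases H : ∃ g : Matrix.SpecialLinearGroup (Fin 2) R, g 0 0 = c.1.1 ∧ g 1 0 = c.1.2
    · exact H.imp fun g hg _ _ _ ↦ hg
    · exact ⟨1, fun h h₀ h₁ ↦ (H ⟨h, h₀, h₁⟩).elim⟩
  choose f hf using hex
  have hinj : Function.Injective fun g : Matrix.SpecialLinearGroup (Fin 2) R ↦
      ((⟨(g 0 0, g 1 0), hs g⟩ : s),
        f ⟨(g 0 0, g 1 0), hs g⟩ 1 1 * g 0 1 - f ⟨(g 0 0, g 1 0), hs g⟩ 0 1 * g 1 1) := by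
    intro g h hgh
    simp only [Prod.mk.injEq, Subtype.mk.injEq] at hgh
    obtain ⟨⟨h₀, h₁⟩, h₂⟩ := hgh
    have hc : (⟨(g 0 0, g 1 0), hs g⟩ : s) = ⟨(h 0 0, h 1 0), hs h⟩ := by
      simp [h₀, h₁]
    rw [← hc] at h₂
    obtain ⟨e₀, e₁⟩ := hf ⟨(g 0 0, g 1 0), hs g⟩ g rfl rfl
    generalize f ⟨(g 0 0, g 1 0), hs g⟩ = a at *
    have da := a.det_coe
    have dg := g.det_coe
    have dh := h.det_coe
    rw [Matrix.det_fin_two] at da dg dh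
    simp only at e₀ e₁
    ext u v
    fin_cases u <;> fin_cases v
    · exact h₀
    · change g 0 1 = h 0 1
      rw [e₀, e₁] at da
      rw [← h₀, ← h₁] at dh
      linear_combination (h 0 1 - g 0 1) * da + g 0 0 * h₂ + a 0 1 * (dg - dh)
    · exact h₁
    · change g 1 1 = h 1 1
      rw [e₀, e₁] at da
      rw [← h₀, ← h₁] at dh
      linear_combination (h 1 1 - g 1 1) * da + g 1 0 * h₂ + a 1 1 * (dg - dh)
  calc Nat.card (Matrix.SpecialLinearGroup (Fin 2) R) ≤ Nat.card (s × R) :=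
        Nat.card_le_card_of_injective _ hinj
    _ = s.ncard * Nat.card R := by rw [Nat.card_prod, Nat.card_coe_set_eq]

lemma card_zmod_five_mul_le {m Q : ℕ} (hQ : Q ≠ 0) (hm : m = 5 * Q) :
    Nat.card (Matrix.SpecialLinearGroup (Fin 2) (ZMod m)) ≤ 120 * Q ^ 3 := by
  have : NeZero m := ⟨by omega⟩
  have hinj {a b : Fin Q} (h : (5 * (a : ℕ) : ZMod m) = 5 * (b : ℕ)) : a = b := by
    have h' : ((5 * a : ℕ) : ZMod m) = ((5 * b : ℕ) : ZMod m) := by exact_mod_cast h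
    have := (ZMod.natCast_eq_natCast_iff' _ _ _).1 h'
    rw [Nat.mod_eq_of_lt (by omega), Nat.mod_eq_of_lt (by omega)] at this
    omega
  set f : Fin Q × Fin Q → ZMod m × ZMod m := fun c ↦ (5 * (c.1 : ℕ), 5 * (c.2 : ℕ)) with hf
  have hfinj : Function.Injective f := fun c d h ↦
    Prod.ext (hinj (Prod.ext_iff.1 h).1) (hinj (Prod.ext_iff.1 h).2)
  have hcard : (Set.range f).ncard = Q ^ 2 := by
    rw [← Nat.card_coe_set_eq, Nat.card_range_of_injective hfinj]
    simp [pow_two]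
  have hcompl : (Set.range f)ᶜ.ncard = 24 * Q ^ 2 := by
    have h := Set.ncard_add_ncard_compl (Set.range f)
    rw [hcard, Nat.card_prod, Nat.card_zmod] at h
    have hmm : m * m = 25 * Q ^ 2 := by rw [hm]; ring
    omega
  refine (card_le_mul_card (Set.range f)ᶜ ?_).trans_eq ?_
  · rintro g ⟨c, hc⟩
    obtain ⟨h₀, h₁⟩ := Prod.ext_iff.1 hc
    simp only [hf] at h₀ h₁
    have dg := g.det_coe
    rw [Matrix.det_fin_two, ← h₀, ← h₁] at dg
    have h5 : (5 * Q : ZMod m) = 0 := by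
      exact_mod_cast (ZMod.natCast_eq_zero_iff (5 * Q) m).2 hm.dvd
    have h0 : (Q : ZMod m) = 0 := by
      linear_combination -Q * dg + (c.1 * g 1 1 - g 0 1 * c.2) * h5
    have := Nat.le_of_dvd (by omega) ((ZMod.natCast_eq_zero_iff _ _).1 h0)
    omega
  · rw [hcompl, Nat.card_zmod, hm]
    ring

/-- The center of `SL₂` contains `±1`. -/
lemma two_le_card_center [Finite R] (h : (2 : R) ≠ 0) :
    2 ≤ Nat.card (Subgroup.center (Matrix.SpecialLinearGroup (Fin 2) R)) := by
  have : Nontrivial (Subgroup.center (Matrix.SpecialLinearGroup (Fin 2) R)) := by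
    refine ⟨1, ⟨-1, Subgroup.mem_center_iff.2 fun g ↦ by simp⟩, fun e ↦ h ?_⟩
    have e' : (1 : Matrix.SpecialLinearGroup (Fin 2) R) = -1 := congrArg Subtype.val e
    have e'' := congrArg (fun g : Matrix.SpecialLinearGroup (Fin 2) R ↦ g 0 0) e'
    simp at e''
    linear_combination e''
  exact Finite.one_lt_card

lemma card_quotient_center_le {m Q : ℕ} (hQ : Q ≠ 0) (hm : m = 5 * Q) :
    Nat.card (Matrix.SpecialLinearGroup (Fin 2) (ZMod m) ⧸
      Subgroup.center (Matrix.SpecialLinearGroup (Fin 2) (ZMod m))) ≤ 60 * Q ^ 3 := by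
  have : NeZero m := ⟨by omega⟩
  have h2 : (2 : ZMod m) ≠ 0 := by
    intro h
    have := Nat.le_of_dvd two_pos ((ZMod.natCast_eq_zero_iff 2 m).1 (by exact_mod_cast h))
    omega
  have h := Subgroup.card_eq_card_quotient_mul_card_subgroup
    (Subgroup.center (Matrix.SpecialLinearGroup (Fin 2) (ZMod m)))
  have h' := card_zmod_five_mul_le hQ hm
  have := two_le_card_center h2
  nlinarith

end Matrix.SpecialLinearGroup

lemma floor_mul_logb_le {p n Q D : ℕ} (hp : 1250 < p) (hn : 0 < n) (hnQ : n ≤ 60 * Q ^ 3)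
    (hQ : Q ^ 4 ≤ 4 * p ^ D) : ⌊(4 / 3 : ℝ) * Real.logb p n⌋ ≤ (D : ℤ) := by
  rw [← Int.lt_add_one_iff, Int.floor_lt]
  have hpow : n ^ 4 < p ^ (3 * (D + 1)) := by
    calc n ^ 4 ≤ (60 * Q ^ 3) ^ 4 := Nat.pow_le_pow_left hnQ 4
      _ = 60 ^ 4 * (Q ^ 4) ^ 3 := by ring
      _ ≤ 60 ^ 4 * (4 * p ^ D) ^ 3 := by gcongr
      _ = (60 ^ 4 * 4 ^ 3) * (p ^ D) ^ 3 := by ring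
      _ < 1250 ^ 3 * (p ^ D) ^ 3 :=
        Nat.mul_lt_mul_of_pos_right (by norm_num) (by positivity)
      _ ≤ p ^ 3 * (p ^ D) ^ 3 := by gcongr
      _ = p ^ (3 * (D + 1)) := by ring
  have hp1 : (1 : ℝ) < p := by exact_mod_cast (by omega : 1 < p)
  have hn0 : (0 : ℝ) < n := by exact_mod_cast hn
  have hlog : Real.logb p ((n : ℝ) ^ 4) < Real.logb p ((p : ℝ) ^ (3 * (D + 1))) :=
    Real.logb_lt_logb hp1 (by positivity) (by exact_mod_cast hpow)
  rw [Real.logb_pow, Real.logb_pow, Real.logb_self_eq_one hp1] at hlog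
  push_cast at hlog ⊢
  linarith

/-- Let `p`, `q` be primes, both `≡ 1 (mod 4)`, with `p > 1250`,
`k ≥ 1`, and `m = 5·q^k`, with `p` coprime to `m` and `−1` and `p` squares mod `m`
(with fixed square roots `i` and `s`). Then the diameter of the LPS Ramanujan graph
`X_{p,m}` on `PSL₂(ZMod m)` satisfies `diam ≥ ⌊(4/3)·log_p n⌋`, where `n` is the
number of vertices of `X_{p,m}`. -/
theorem lps_diameter_lower_bound_floor
    (p q k : ℕ) (hp : p.Prime) (hq : q.Prime)
    (hp4 : p % 4 = 1) (hq4 : q % 4 = 1) (hp1250 : 1250 < p) (hk : 1 ≤ k)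
    (m : ℕ) (hm : m = 5 * q ^ k) (hcop : Nat.Coprime p m)
    (i s : ZMod m) (hi : i ^ 2 = -1) (hs : s ^ 2 = (p : ZMod m))
    (X : SimpleGraph
      (SpecialLinearGroup (Fin 2) (ZMod m) ⧸
        Subgroup.center (SpecialLinearGroup (Fin 2) (ZMod m))))
    (hX : X = SimpleGraph.fromRel (fun x y =>
      ∃ (A : SpecialLinearGroup (Fin 2) (ZMod m)) (x₀ x₁ x₂ x₃ : ℤ),
        x₀ ^ 2 + x₁ ^ 2 + x₂ ^ 2 + x₃ ^ 2 = (p : ℤ) ∧ 0 < x₀ ∧ Odd x₀ ∧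
        Even x₁ ∧ Even x₂ ∧ Even x₃ ∧
        (A : Matrix (Fin 2) (Fin 2) (ZMod m)) =
          s⁻¹ •
            !![(x₀ : ZMod m) + i * (x₁ : ZMod m), (x₂ : ZMod m) + i * (x₃ : ZMod m);
               -(x₂ : ZMod m) + i * (x₃ : ZMod m), (x₀ : ZMod m) - i * (x₁ : ZMod m)] ∧
        y = x * QuotientGroup.mk A)) :
    ⌊(4 / 3 : ℝ) * Real.logb p
        (Nat.card (SpecialLinearGroup (Fin 2) (ZMod m) ⧸
          Subgroup.center (SpecialLinearGroup (Fin 2) (ZMod m))))⌋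
      ≤ (X.diam : ℤ) := by
  have hq0 : q ^ k ≠ 0 := pow_ne_zero k hq.ne_zero
  have hm0 : m ≠ 0 := by omega
  have : NeZero m := ⟨hm0⟩
  have hm4 : m % 4 = 1 := by
    have hqk : q ^ k % 4 = 1 := by simp [Nat.pow_mod, hq4]
    omega
  have hw : s⁻¹ ^ 2 * (p : ZMod m) = 1 := by
    have hsu : IsUnit s := by
      rw [← isUnit_pow_iff two_ne_zero, hs]
      exact (ZMod.isUnit_iff_coprime p m).2 hcop
    rw [← hs, ← mul_pow, ZMod.inv_mul_of_unit s hsu, one_pow]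
  have hX' : X = SimpleGraph.fromRel fun x y ↦
      ∃ a ∈ Quaternion.lpsGenerators i s⁻¹ p, y = x * a := by
    rw [hX]
    congr 1
    funext x y
    refine propext ⟨?_, ?_⟩
    · rintro ⟨A, x₀, x₁, x₂, x₃, hsum, h₀, ho, h₁, h₂, h₃, hA, rfl⟩
      exact ⟨QuotientGroup.mk A, ⟨A, ⟨x₀, x₁, x₂, x₃⟩, rfl,
        (Quaternion.normSq_def' _).trans hsum, h₀, ⟨ho, h₁, h₂, h₃⟩, hA⟩, rfl⟩
    · rintro ⟨_, ⟨A, α, rfl, hN, h₀, ⟨ho, h₁, h₂, h₃⟩, hA⟩, rfl⟩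
      exact ⟨A, α.re, α.imI, α.imJ, α.imK, (Quaternion.normSq_def' α).symm.trans hN,
        h₀, ho, h₁, h₂, h₃, hA, rfl⟩
  have htop := Quaternion.closure_lpsGenerators_eq_top hi hw hp hp4
    (Quaternion.primarySubgroup_eq_top Nat.prime_five hq (by omega) hm hm4 hp
      (Nat.odd_iff.2 (by omega)) hcop hi hw)
  have hbound := Quaternion.pow_le_four_mul_pow hp hq (by omega) (by omega) hm hcop hi
    (Quaternion.exists_toMatrix_eq_smul hi hw htop)
  rw [← hX'] at hbound
  exact floor_mul_logb_le hp1250 Nat.card_pos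
    (Matrix.SpecialLinearGroup.card_quotient_center_le hq0 hm) hbound
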